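/- Let m ≥ 2. Then −((2m−1)/(m!·(m−1)!)) · S(Gr_m) = Alt_{2m} S I(0; 0, ρ_1, ρ_2, …, ρ_{m−1}; ρ_m) in V_F^{⊗m}, where S(Gr_m) := 2·(−1)^m·(m!)²·Alt_{2m}[ [⟨1,…,m⟩] ⊗ [⟨2,…,m+1⟩] ⊗ … ⊗ [⟨m,…,2m−1⟩] ]. -/

import Mathlib

open scoped TensorProduct
open PiTensorProduct

attribute [local instance] Classical.propDecidable

set_option maxHeartbeats 1000000
set_option synthInstance.maxHeartbeats 400000

noncomputable section

namespace GrassPoly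

variable (F : Type) [Field F]

/-- `V_F = F^× ⊗_ℤ ℚ` as a `ℚ`-vector space. -/
abbrev VF : Type := ℚ ⊗[ℤ] (Additive Fˣ)

variable {F}

/-- The class `[a]` of a nonzero field element in `V_F` (defined to be `0` for `a = 0`). -/
def cls (a : F) : VF F :=
  if h : a = 0 then 0 else (1 : ℚ) ⊗ₜ[ℤ] (Additive.ofMul (Units.mk0 a h))

variable (F) in
/-- Tensor powers of V_F over ℚ. -/
abbrev TP (n : ℕ) : Type := ⨂[ℚ]^n (VF F)

instance instTPAddCommGroup (n : ℕ) : AddCommGroup (TP F n) :=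
  Module.addCommMonoidToAddCommGroup ℚ

/-- Appending one extra tensor factor on the right. -/
def snoc {n : ℕ} : TP F n →ₗ[ℚ] VF F →ₗ[ℚ] TP F (n + 1) :=
  PiTensorProduct.lift
    ((PiTensorProduct.tprod ℚ (s := fun _ : Fin (n + 1) => VF F)).curryRight)

/-- The factor `t_i` appearing in the recursive definition of the symbol,
as a function of `(a_{i-1}, a_i, a_{i+1})`. -/
def tCoef (p a q : F) : VF F :=
  if p = a then (if a = q then 0 else cls (q - a))
  else if a = q then - cls (p - a)
  else cls ((q - a) / (p - a))

/-- The symbol `S I(a₀; a₁, …, a_m; a_{m+1})`, with the middle entries given as a list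
(of length `n`). -/
def SIaux : (n : ℕ) → (a0 : F) → (as : List F) → (b : F) → as.length = n → TP F n
  | 0, _, _, _, _ => tprod ℚ (fun i : Fin 0 => i.elim0)
  | n + 1, a0, as, b, h =>
      ∑ i : Fin (n + 1),
        snoc (SIaux n a0 (as.eraseIdx i.val) b
            (by
              have hi' := i.isLt
              have hi : i.val < as.length := by omega
              have h2 := List.length_eraseIdx_of_lt hi
              omega))
          (tCoef ((a0 :: as).getD i.val 0) (as.getD i.val 0) ((as ++ [b]).getD (i.val + 1) 0))

/-- Cyclic rotation `b₁ ⊗ … ⊗ b_N ↦ b₂ ⊗ … ⊗ b_N ⊗ b₁` on tensor powers. -/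
def rotN (n : ℕ) : TP F n ≃ₗ[ℚ] TP F n :=
  PiTensorProduct.reindex ℚ (fun _ : Fin n => VF F) (finRotate n).symm

/-- Splitting off the last tensor factor. -/
def splitLast (n : ℕ) : TP F (n + 1) ≃ₗ[ℚ] (TP F n) ⊗[ℚ] (VF F) :=
  ((PiTensorProduct.reindex ℚ (fun _ : Fin (n + 1) => VF F)
      (finSumFinEquiv (m := n) (n := 1)).symm).trans
    (PiTensorProduct.tmulEquiv ℚ (VF F)).symm).trans
    (TensorProduct.congr (LinearEquiv.refl ℚ _)
      (PiTensorProduct.subsingletonEquiv (0 : Fin 1)))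

/-- The projector `Π̃_N` annihilating symbols of products. -/
def Pit : (n : ℕ) → TP F n →ₗ[ℚ] TP F n
  | 0 => LinearMap.id
  | 1 => LinearMap.id
  | (n + 2) =>
      ((splitLast (n + 1)).symm.toLinearMap
        ∘ₗ TensorProduct.map (Pit (n + 1)) LinearMap.id
        ∘ₗ (splitLast (n + 1)).toLinearMap)
      ∘ₗ ((LinearMap.id : TP F (n + 2) →ₗ[ℚ] TP F (n + 2)) - (rotN (F := F) (n + 2)).toLinearMap)

/-- The map on `V_F` induced by a field automorphism. -/
def vmap (φ : F ≃+* F) : VF F →ₗ[ℚ] VF F :=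
  TensorProduct.AlgebraTensorModule.map (LinearMap.id : ℚ →ₗ[ℚ] ℚ)
    (AddMonoidHom.toIntLinearMap
      { toFun := fun a => Additive.ofMul ((Units.map (φ : F →* F)) a.toMul)
        map_zero' := by simp
        map_add' := by intro a b; simp [_root_.map_mul] })

/-- The induced map on tensor powers. -/
def tpMap {n : ℕ} (φ : F ≃+* F) : TP F n →ₗ[ℚ] TP F n :=
  PiTensorProduct.map (fun _ => vmap φ)


/-! ### Symbols of (multiple) polylogarithms -/

/-- Symbol of `Li₂`. -/
def SLi2 (x : F) : TP F 2 := - SIaux 2 0 [x⁻¹, 0] 1 rfl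

/-- Symbol of `Li₃`. -/
def SLi3 (x : F) : TP F 3 := - SIaux 3 0 [x⁻¹, 0, 0] 1 rfl

/-- Symbol of `Li₄`. -/
def SLi4 (x : F) : TP F 4 := - SIaux 4 0 [x⁻¹, 0, 0, 0] 1 rfl

/-- Symbol of `Li₅`. -/
def SLi5 (x : F) : TP F 5 := - SIaux 5 0 [x⁻¹, 0, 0, 0, 0] 1 rfl

/-- Symbol of `I_{3,1}(x,y) = I(0; x,0,0,y; 1)`. -/
def SI31 (x y : F) : TP F 4 := SIaux 4 0 [x, 0, 0, y] 1 rfl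

/-- Symbol of `I_{4,1}(x,y) = I(0; x,0,0,0,y; 1)`. -/
def SI41 (x y : F) : TP F 5 := SIaux 5 0 [x, 0, 0, 0, y] 1 rfl

/-- Symbol of `I⁺_{4,1}(x,y) = ½ (I_{4,1}(x,y) + I_{4,1}(x,y⁻¹))`. -/
def I41p (x y : F) : TP F 5 := (2 : ℚ)⁻¹ • (SI41 x y + SI41 x y⁻¹)

/-- The anharmonic orbit of `x`, together with the signs of the
corresponding permutations in `S₃`. -/
def anhList (x : F) : List (ℚ × F) :=
  [(1, x), (1, (1 - x)⁻¹), (1, 1 - x⁻¹), (-1, x⁻¹), (-1, 1 - x), (-1, x / (x - 1))]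

/-- Symbol of `Ĩ_{3,1}(x,y) = (1/36) Σ_{σ,π ∈ S₃} sgn(σ) sgn(π) I_{3,1}(x^σ, y^π)`. -/
def tI31 (x y : F) : TP F 4 :=
  (36 : ℚ)⁻¹ •
    ((anhList x).map (fun p =>
      ((anhList y).map (fun q => (p.1 * q.1) • SI31 p.2 q.2)).sum)).sum

/-- Symbol of `Ĩ⁺_{4,1}(x,y) = (1/6) Σ_{σ ∈ S₃} sgn(σ) I⁺_{4,1}(x^σ, y)`. -/
def tI41p (x y : F) : TP F 5 :=
  (6 : ℚ)⁻¹ • ((anhList x).map (fun p => p.1 • I41p p.2 y)).sum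

/-- Symbol of `V(z; x, y) = Ĩ_{3,1}(z, [x]+[y]+[(1-x)/(1-xy)]+[1-xy]+[(1-y)/(1-xy)])`. -/
def Vc (z x y : F) : TP F 4 :=
  tI31 z x + tI31 z y + tI31 z ((1 - x) / (1 - x * y)) + tI31 z (1 - x * y)
    + tI31 z ((1 - y) / (1 - x * y))

/-- `Sym₃₆(a,b) := I_{3,1}(a,b) - Ĩ_{3,1}(a,b)` (on the level of symbols). -/
def S36 (a b : F) : TP F 4 := SI31 a b - tI31 a b

/-! ### Generic vectors -/

variable (N m : ℕ)

/-- Polynomial ring on the entries of `N` generic vectors in `m`-space. -/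
abbrev Pol : Type := MvPolynomial (Fin N × Fin m) ℚ

/-- The field of rational functions in the entries of `N` generic vectors in `m`-space. -/
abbrev FF : Type := FractionRing (Pol N m)

/-- The `j`-th coordinate of the `i`-th generic vector. -/
def gen (i : Fin N) (j : Fin m) : FF N m :=
  algebraMap (Pol N m) (FF N m) (MvPolynomial.X (i, j))

/-- `⟨i₁ … i_m⟩`: the determinant of the matrix whose columns are
the generic vectors selected by `cols`. -/
def dets (cols : Fin m → Fin N) : FF N m :=
  (Matrix.of fun r c => gen N m (cols c) r).det

/-- The field automorphism of `FF N m` induced by a permutation of the `N` vectors. -/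
def permAut (σ : Equiv.Perm (Fin N)) : FF N m ≃+* FF N m :=
  IsFractionRing.ringEquivOfRingEquiv
    ((MvPolynomial.renameEquiv ℚ (σ.prodCongr (Equiv.refl (Fin m)))).toRingEquiv)

variable {N m}

/-- Skew-symmetrization over all permutations of the `N` generic vectors. -/
def Alt {n : ℕ} (x : TP (FF N m) n) : TP (FF N m) n :=
  ∑ σ : Equiv.Perm (Fin N), (((Equiv.Perm.sign σ : ℤˣ) : ℤ) : ℚ) • tpMap (permAut N m σ) x

end GrassPoly

end

namespace GrassPoly

noncomputable section GenWeight

/-- An index in `Fin (2k+4)`, from a `0`-based natural number. -/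
def fin2m (k : ℕ) (x : ℕ) : Fin (2 * k + 4) := ⟨x % (2 * k + 4), Nat.mod_lt _ (by omega)⟩

/-- Determinants of `m = k+2` of the `2m` generic vectors in `m`-space. -/
def gdet (k : ℕ) (cols : Fin (k + 2) → Fin (2 * k + 4)) : FF (2 * k + 4) (k + 2) :=
  dets (2 * k + 4) (k + 2) cols

/-- `ρ_i = ⟨i, i+1, …, i+m-2, 2m-1⟩ / ⟨i, i+1, …, i+m-2, 2m⟩` (1-based labels, `m = k+2`). -/
def grho (k i : ℕ) : FF (2 * k + 4) (k + 2) :=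
  gdet k (fun t => if t.val < k + 1 then fin2m k (i - 1 + t.val) else fin2m k (2 * k + 2)) /
    gdet k (fun t => if t.val < k + 1 then fin2m k (i - 1 + t.val) else fin2m k (2 * k + 3))

/-- `S(Gr_m) = 2·(-1)^m·(m!)²·Alt_{2m}[⟨1,…,m⟩ ⊗ ⟨2,…,m+1⟩ ⊗ ⋯ ⊗ ⟨m,…,2m-1⟩]`, `m = k+2`. -/
def SGrm (k : ℕ) : TP (FF (2 * k + 4) (k + 2)) (k + 2) :=
  ((2 : ℚ) * (-1 : ℚ) ^ (k + 2) * ((Nat.factorial (k + 2) : ℚ)) ^ 2) •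
    Alt (tprod ℚ (fun j : Fin (k + 2) => cls (gdet k (fun c => fin2m k (j.val + c.val)))))

end GenWeight

end GrassPoly

open GrassPoly

namespace GrassPoly

section Classes

variable {F : Type} [Field F]

theorem cls_mul {a b : F} (ha : a ≠ 0) (hb : b ≠ 0) : cls (a * b) = cls a + cls b := by
  rw [cls, cls, cls, dif_neg ha, dif_neg hb, dif_neg (mul_ne_zero ha hb), ← TensorProduct.tmul_add,
    ← ofMul_mul, Units.mk0_mul]

theorem cls_div {a b : F} (ha : a ≠ 0) (hb : b ≠ 0) : cls (a / b) = cls a - cls b := by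
  rw [eq_sub_iff_add_eq, ← cls_mul (div_ne_zero ha hb) hb, div_mul_cancel₀ _ hb]

theorem cls_one : cls (1 : F) = 0 := by
  have h := cls_mul (one_ne_zero (α := F)) one_ne_zero
  rw [mul_one] at h
  exact left_eq_add.mp h

theorem cls_neg (a : F) : cls (-a) = cls a := by
  by_cases ha : a = 0
  · rw [ha, neg_zero]
  have h1 : (-1 : F) ≠ 0 := neg_ne_zero.mpr one_ne_zero
  have h : cls (-1 : F) + cls (-1 : F) = 0 := by
    rw [← cls_mul h1 h1, neg_one_mul, neg_neg, cls_one]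
  have h0 : cls (-1 : F) = 0 := by
    rw [← two_smul ℚ] at h
    exact (smul_eq_zero.mp h).resolve_left two_ne_zero
  rw [← neg_one_mul, cls_mul h1 ha, h0, zero_add]

theorem vmap_cls (φ : F ≃+* F) (a : F) : vmap φ (cls a) = cls (φ a) := by
  by_cases ha : a = 0
  · simp [cls, ha]
  · have hφ : φ a ≠ 0 := (map_ne_zero φ).mpr ha
    rw [cls, cls, dif_neg ha, dif_neg hφ, vmap, TensorProduct.AlgebraTensorModule.map_tmul]
    congr 1
    exact congrArg Additive.ofMul (Units.ext rfl)

theorem vmap_tCoef (φ : F ≃+* F) (p a q : F) :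
    vmap φ (tCoef p a q) = tCoef (φ p) (φ a) (φ q) := by
  simp only [tCoef, φ.injective.eq_iff]
  split_ifs <;> simp [vmap_cls]

theorem snoc_tprod {n : ℕ} (f : Fin n → VF F) (t : VF F) :
    snoc (tprod ℚ f) t = tprod ℚ (Fin.snoc f t : Fin (n + 1) → VF F) := by
  rw [snoc, PiTensorProduct.lift.tprod]
  rfl

theorem tpMap_tprod {n : ℕ} (φ : F ≃+* F) (f : Fin n → VF F) :
    tpMap φ (tprod ℚ f) = tprod ℚ (fun i => vmap φ (f i)) :=
  PiTensorProduct.map_tprod _ _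

theorem tpMap_snoc {n : ℕ} (φ : F ≃+* F) (X : TP F n) (t : VF F) :
    tpMap φ (snoc X t) = snoc (tpMap φ X) (vmap φ t) := by
  induction X using PiTensorProduct.induction_on with
  | smul_tprod r f =>
    simp only [map_smul, LinearMap.smul_apply, snoc_tprod, tpMap_tprod]
    congr 2
    funext i
    refine Fin.lastCases ?_ (fun j => ?_) i <;> simp
  | add x y hx hy => simp only [map_add, LinearMap.add_apply, hx, hy]

theorem tpMap_SIaux (φ : F ≃+* F) (n : ℕ) (a : F) (as : List F) (b : F) (h : as.length = n)
    (h' : (as.map φ).length = n) :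
    tpMap φ (SIaux n a as b h) = SIaux n (φ a) (as.map φ) (φ b) h' := by
  induction n generalizing as with
  | zero =>
    rw [SIaux, SIaux, tpMap_tprod]
    congr 1
    funext i
    exact i.elim0
  | succ n ih =>
    rw [SIaux, SIaux, map_sum]
    refine Finset.sum_congr rfl fun i _ => ?_
    have hget : ∀ (l : List F) (j : ℕ), φ (l.getD j 0) = (l.map φ).getD j 0 := fun l j => by
      simp only [List.getD_eq_getElem?_getD, List.getElem?_map]
      cases l[j]? <;> simp
    rw [tpMap_snoc, vmap_tCoef, hget, hget, hget,
      ih _ _ (by rw [List.length_map]; have := i.isLt; rw [List.length_eraseIdx_of_lt] <;> omega)]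
    simp only [List.map_cons, List.map_append, List.map_nil, List.eraseIdx_map]

end Classes

section Determinants

variable {N m : ℕ}

theorem dets_ne_zero {c : Fin m → Fin N} (hc : Function.Injective c) : dets N m c ≠ 0 := by
  have h : dets N m c = algebraMap (Pol N m) (FF N m)
      (Matrix.of fun r j => MvPolynomial.X (c j, r)).det := by
    rw [RingHom.map_det]
    rfl
  rw [h, Ne, FaithfulSMul.algebraMap_eq_zero_iff]
  intro h0
  have h1 := congrArg
    (MvPolynomial.eval fun p : Fin N × Fin m => if p.1 = c p.2 then (1 : ℚ) else 0) h0
  rw [RingHom.map_det, map_zero] at h1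
  have h2 : (MvPolynomial.eval fun p : Fin N × Fin m =>
      if p.1 = c p.2 then (1 : ℚ) else 0).mapMatrix
        (Matrix.of fun r j => MvPolynomial.X (c j, r)) = 1 := by
    ext r j
    simp [Matrix.one_apply, hc.eq_iff, eq_comm]
  rw [h2, Matrix.det_one] at h1
  exact one_ne_zero h1

theorem dets_comp_perm (c : Fin m → Fin N) (π : Equiv.Perm (Fin m)) :
    dets N m (c ∘ π) = ((Equiv.Perm.sign π : ℤ) : FF N m) * dets N m c :=
  Matrix.det_permute' π (Matrix.of fun r j => gen N m (c j) r)

theorem cls_dets_comp_perm (c : Fin m → Fin N) (π : Equiv.Perm (Fin m)) :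
    cls (dets N m (c ∘ π)) = cls (dets N m c) := by
  rw [dets_comp_perm]
  rcases Int.units_eq_one_or (Equiv.Perm.sign π) with h | h <;> simp [h, cls_neg]

theorem permAut_gen (σ : Equiv.Perm (Fin N)) (i : Fin N) (j : Fin m) :
    permAut N m σ (gen N m i j) = gen N m (σ i) j := by
  simp [permAut, gen]

theorem permAut_dets (σ : Equiv.Perm (Fin N)) (c : Fin m → Fin N) :
    permAut N m σ (dets N m c) = dets N m (σ ∘ c) := by
  rw [dets, dets, RingEquiv.map_det]
  congr 1
  ext r j
  exact permAut_gen σ (c j) r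

theorem permAut_mul (σ τ : Equiv.Perm (Fin N)) (x : FF N m) :
    permAut N m (σ * τ) x = permAut N m σ (permAut N m τ x) := by
  have h : ((permAut N m (σ * τ) : FF N m →+* FF N m)) =
      ((permAut N m σ : FF N m →+* FF N m)).comp (permAut N m τ) := by
    refine IsFractionRing.ringHom_ext (A := Pol N m) fun p => ?_
    simp [permAut, MvPolynomial.rename_rename]
    rfl
  exact RingHom.congr_fun h x

theorem exists_perm_of_range_eq {ι α : Type*} {c d : ι → α} (hc : Function.Injective c)
    (hd : Function.Injective d) (h : Set.range c = Set.range d) :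
    ∃ π : Equiv.Perm ι, d = c ∘ π := by
  refine ⟨(Equiv.ofInjective d hd).trans
    ((Equiv.setCongr h.symm).trans (Equiv.ofInjective c hc).symm), ?_⟩
  funext i
  simp [Equiv.apply_ofInjective_symm]

/-- The class of the determinant whose columns are the vectors with labels in `A`. -/
noncomputable def clsSet (m : ℕ) (A : Set (Fin N)) : VF (FF N m) :=
  if h : ∃ c : Fin m → Fin N, Function.Injective c ∧ Set.range c = A then
    cls (dets N m h.choose) else 0

theorem cls_dets {c : Fin m → Fin N} (hc : Function.Injective c) {A : Set (Fin N)}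
    (hA : Set.range c = A) : cls (dets N m c) = clsSet m A := by
  have h : ∃ c : Fin m → Fin N, Function.Injective c ∧ Set.range c = A := ⟨c, hc, hA⟩
  rw [clsSet, dif_pos h]
  obtain ⟨π, hπ⟩ := exists_perm_of_range_eq hc h.choose_spec.1 (hA.trans h.choose_spec.2.symm)
  rw [hπ, cls_dets_comp_perm]

theorem vmap_clsSet (σ : Equiv.Perm (Fin N)) (A : Set (Fin N)) :
    vmap (permAut N m σ) (clsSet m A) = clsSet m (σ '' A) := by
  by_cases h : ∃ c : Fin m → Fin N, Function.Injective c ∧ Set.range c = A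
  · obtain ⟨c, hc, hA⟩ := h
    rw [← cls_dets hc hA, vmap_cls, permAut_dets]
    exact cls_dets (σ.injective.comp hc) (by rw [Set.range_comp, hA])
  · have h' : ¬∃ c : Fin m → Fin N, Function.Injective c ∧ Set.range c = σ '' A := by
      rintro ⟨c, hc, hA⟩
      refine h ⟨σ.symm ∘ c, σ.symm.injective.comp hc, ?_⟩
      rw [Set.range_comp, hA, ← Set.image_comp]
      simp
    rw [clsSet, clsSet, dif_neg h, dif_neg h', map_zero]

theorem tpMap_permAut_mul {n : ℕ} (σ τ : Equiv.Perm (Fin N)) (X : TP (FF N m) n) :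
    tpMap (permAut N m (σ * τ)) X = tpMap (permAut N m σ) (tpMap (permAut N m τ) X) := by
  have hv : ∀ v : VF (FF N m), vmap (permAut N m (σ * τ)) v =
      vmap (permAut N m σ) (vmap (permAut N m τ) v) := fun v => by
    induction v using TensorProduct.induction_on with
    | zero => simp only [map_zero]
    | add x y hx hy => simp only [map_add, hx, hy]
    | tmul q a =>
      simp only [vmap, TensorProduct.AlgebraTensorModule.map_tmul]
      congr 1
      exact congrArg Additive.ofMul (Units.ext (permAut_mul σ τ _))
  induction X using PiTensorProduct.induction_on with
  | smul_tprod r f => simp only [map_smul, tpMap_tprod, hv]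
  | add x y hx hy => simp only [map_add, hx, hy]

theorem Alt_tpMap {n : ℕ} (τ : Equiv.Perm (Fin N)) (X : TP (FF N m) n) :
    Alt (tpMap (permAut N m τ) X) = (((Equiv.Perm.sign τ : ℤˣ) : ℤ) : ℚ) • Alt X := by
  rw [Alt, Alt, Finset.smul_sum]
  refine Fintype.sum_equiv (Equiv.mulRight τ) _ _ fun σ => ?_
  rw [Equiv.coe_mulRight, tpMap_permAut_mul, smul_smul]
  congr 1
  rcases Int.units_eq_one_or (Equiv.Perm.sign τ) with h | h <;>
    simp [Equiv.Perm.sign_mul, h]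

/-- `Alt` as a linear map. -/
noncomputable def altHom (N m n : ℕ) : TP (FF N m) n →ₗ[ℚ] TP (FF N m) n :=
  ∑ σ : Equiv.Perm (Fin N),
    (((Equiv.Perm.sign σ : ℤˣ) : ℤ) : ℚ) • tpMap (permAut N m σ)

theorem altHom_apply {n : ℕ} (X : TP (FF N m) n) : altHom N m n X = Alt X := by
  simp [altHom, Alt, LinearMap.sum_apply]

/-- The determinant on the columns `x, C, y`. -/
noncomputable def wedge {k : ℕ} (C : Fin k → Fin N) (x y : Fin N) : FF N (k + 2) :=
  dets N (k + 2) (Fin.cons x (Fin.snoc C y : Fin (k + 1) → Fin N))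

theorem det_pluecker {R : Type*} [CommRing R] {k : ℕ} (C : Fin k → Fin (k + 2) → R)
    (a b c d : Fin (k + 2) → R) :
    (Matrix.of (Fin.cons a (Fin.snoc C b : Fin (k + 1) → _) : Fin (k + 2) → _)).det *
        (Matrix.of (Fin.cons c (Fin.snoc C d : Fin (k + 1) → _) : Fin (k + 2) → _)).det =
      (Matrix.of (Fin.cons c (Fin.snoc C b : Fin (k + 1) → _) : Fin (k + 2) → _)).det *
        (Matrix.of (Fin.cons a (Fin.snoc C d : Fin (k + 1) → _) : Fin (k + 2) → _)).det +
      (Matrix.of (Fin.cons a (Fin.snoc C c : Fin (k + 1) → _) : Fin (k + 2) → _)).det *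
        (Matrix.of (Fin.cons b (Fin.snoc C d : Fin (k + 1) → _) : Fin (k + 2) → _)).det := by
  set A : Matrix (Fin (k + 2)) (Fin (k + 2)) R :=
    Matrix.of (Fin.cons a (Fin.snoc C b : Fin (k + 1) → _) : Fin (k + 2) → _) with hA
  let f : (Fin (k + 2) → R) →ₗ[R] R :=
    Matrix.detRowAlternating.toMultilinearMap.toLinearMap
      (Fin.cons 0 (Fin.snoc C d : Fin (k + 1) → _) : Fin (k + 2) → Fin (k + 2) → R) 0
  have hf : ∀ z, f z =
      (Matrix.of (Fin.cons z (Fin.snoc C d : Fin (k + 1) → _) : Fin (k + 2) → _)).det := by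
    intro z
    change Matrix.det (Function.update _ _ _) = _
    rw [Fin.update_cons_zero]
    rfl
  have hC : ∀ i, f (C i) = 0 := by
    intro i
    rw [hf]
    refine Matrix.det_zero_of_row_eq (i := 0) (j := i.castSucc.succ) (Fin.succ_ne_zero _).symm ?_
    change C i = (Fin.snoc C d : Fin (k + 1) → Fin (k + 2) → R) i.castSucc
    rw [Fin.snoc_castSucc]
  have h := congrArg f (Matrix.mulVec_cramer A.transpose c)
  rw [Matrix.mulVec_eq_sum, map_sum, map_smul, Fin.sum_univ_succ, Fin.sum_univ_castSucc] at h
  simp only [Matrix.transpose_transpose, op_smul_eq_smul, map_smul, Matrix.cramer_transpose_apply,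
    Matrix.det_transpose] at h
  have h0 : A 0 = a := rfl
  have h1 : ∀ i : Fin k, A i.castSucc.succ = C i :=
    Fin.snoc_castSucc (α := fun _ => Fin (k + 2) → R) b C
  have h2 : A (Fin.last k).succ = b := Fin.snoc_last (α := fun _ => Fin (k + 2) → R) b C
  have h3 : A.updateRow 0 c =
      Matrix.of (Fin.cons c (Fin.snoc C b : Fin (k + 1) → _) : Fin (k + 2) → _) :=
    Fin.update_cons_zero (α := fun _ => Fin (k + 2) → R) a (Fin.snoc C b) c
  have h4 : A.updateRow (Fin.last k).succ c =
      Matrix.of (Fin.cons a (Fin.snoc C c : Fin (k + 1) → _) : Fin (k + 2) → _) := by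
    change Function.update (Fin.cons a (Fin.snoc C b : Fin (k + 1) → _) : Fin (k + 2) → _) _ _ = _
    rw [← Fin.cons_update, Fin.update_snoc_last]
    rfl
  simp only [h0, h1, h2, h3, h4, hC, hf, smul_eq_mul, mul_zero,
    Finset.sum_const_zero, zero_add] at h
  exact h.symm

theorem wedge_pluecker {k : ℕ} (C : Fin k → Fin N) (a b c d : Fin N) :
    wedge C a b * wedge C c d = wedge C c b * wedge C a d + wedge C a c * wedge C b d := by
  have h : ∀ x y, wedge C x y = (Matrix.of (Fin.cons (gen N (k + 2) x)
      (Fin.snoc (fun i => gen N (k + 2) (C i)) (gen N (k + 2) y) : Fin (k + 1) → _) :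
        Fin (k + 2) → _)).det := fun x y => by
    rw [wedge, dets, ← Matrix.det_transpose]
    congr 1
    ext p r
    refine Fin.cases ?_ (fun q => Fin.lastCases ?_ (fun i => ?_) q) p <;>
      simp [Matrix.transpose_apply, -Fin.succ_last]
  simp only [h]
  exact det_pluecker _ _ _ _ _

end Determinants

section Words

/-- The sequence `L` with the extra entry `z` inserted in position `q`. -/
def insWord {α : Type*} (q : ℕ) (L : ℕ → α) (z : α) (p : ℕ) : α :=
  if p < q then L p else if p = q then z else L (p - 1)

/-- The four sets of `k + 2` labels that contain the `k` labels strictly between `i` and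
`i + k + 1`, one of `i`, `2k + 3` and one of `i + k + 1`, `2k + 2`. -/
def letL (k i : ℕ) (e : Bool × Bool) : Set (Fin (2 * k + 4)) :=
  {v | (i < v.val ∧ v.val < i + k + 1) ∨ (v.val = i ∧ e.1 = true) ∨
    (v.val = i + k + 1 ∧ e.2 = true) ∨ (v.val = 2 * k + 2 ∧ e.2 = false) ∨
    (v.val = 2 * k + 3 ∧ e.1 = false)}

/-- The `k + 1` labels starting at `s`, together with `2k + 2`. -/
def letD (k s : ℕ) : Set (Fin (2 * k + 4)) :=
  {v | (s ≤ v.val ∧ v.val < s + k + 1) ∨ v.val = 2 * k + 2}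

/-- The `k + 1` labels starting at `s`, together with `2k + 3`. -/
def letE (k s : ℕ) : Set (Fin (2 * k + 4)) :=
  {v | (s ≤ v.val ∧ v.val < s + k + 1) ∨ v.val = 2 * k + 3}

/-- The word `letL 0, …, letL k` with `letD s` inserted in position `s`. -/
def wordD (k s : ℕ) (e : ℕ → Bool × Bool) (p : Fin (k + 2)) : Set (Fin (2 * k + 4)) :=
  insWord s (fun i => letL k i (e i)) (letD k s) p

/-- The word `letL 0, …, letL k` with `letE s` inserted in position `s`. -/
def wordE (k s : ℕ) (e : ℕ → Bool × Bool) (p : Fin (k + 2)) : Set (Fin (2 * k + 4)) :=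
  insWord s (fun i => letL k i (e i)) (letE k s) p

theorem insWord_of_lt {α : Type*} {q p : ℕ} (h : p < q) (L : ℕ → α) (z : α) :
    insWord q L z p = L p :=
  if_pos h

theorem insWord_self {α : Type*} (q : ℕ) (L : ℕ → α) (z : α) : insWord q L z q = z := by
  simp [insWord]

theorem insWord_of_gt {α : Type*} {q p : ℕ} (h : q ≤ p) (L : ℕ → α) (z : α) :
    insWord q L z (p + 1) = L p := by
  rw [insWord, if_neg (by omega), if_neg (by omega), Nat.add_sub_cancel]

variable {k : ℕ} {V : Type*} [AddCommGroup V] {W : (Fin (k + 2) → Set (Fin (2 * k + 4))) → V}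

/-- Sign change of a function of words under transpositions of labels. -/
def IsAlt (W : (Fin (k + 2) → Set (Fin (2 * k + 4))) → V) : Prop :=
  ∀ a b, a ≠ b → ∀ M, W (fun p => Equiv.swap a b ⁻¹' M p) = -W M

theorem IsAlt.eq_neg (hW : IsAlt W) {a b : Fin (2 * k + 4)} (hab : a ≠ b)
    {M M' : Fin (k + 2) → Set (Fin (2 * k + 4))} (ha : ∀ p, a ∈ M' p ↔ b ∈ M p)
    (hb : ∀ p, b ∈ M' p ↔ a ∈ M p) (h : ∀ p v, v ≠ a → v ≠ b → (v ∈ M' p ↔ v ∈ M p)) :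
    W M' = -W M := by
  rw [← hW a b hab]
  congr 1
  ext p v
  rw [Set.mem_preimage]
  rcases eq_or_ne v a with rfl | hva
  · rw [Equiv.swap_apply_left, ha]
  rcases eq_or_ne v b with rfl | hvb
  · rw [Equiv.swap_apply_right, hb]
  · rw [Equiv.swap_apply_of_ne_of_ne hva hvb, h p v hva hvb]

theorem IsAlt.eq_zero [Module ℚ V] (hW : IsAlt W) {a b : Fin (2 * k + 4)} (hab : a ≠ b)
    {M : Fin (k + 2) → Set (Fin (2 * k + 4))} (h : ∀ p, a ∈ M p ↔ b ∈ M p) : W M = 0 := by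
  have h1 : W M = -W M := hW.eq_neg hab h (fun p => (h p).symm) fun _ _ _ _ => Iff.rfl
  have h2 : (2 : ℚ) • W M = 0 := by
    rw [two_smul]
    exact add_eq_zero_iff_eq_neg.mpr h1
  exact (smul_eq_zero.mp h2).resolve_left two_ne_zero

/-- `M'` is obtained from `M` by exchanging the labels `a` and `b`. -/
def IsSwap {N : ℕ} (a b : Fin N) (M M' : Set (Fin N)) : Prop :=
  (a ∈ M' ↔ b ∈ M) ∧ (b ∈ M' ↔ a ∈ M) ∧ ∀ v, v ≠ a → v ≠ b → (v ∈ M' ↔ v ∈ M)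

theorem IsAlt.wordD_eq_neg (hW : IsAlt W) {a b : Fin (2 * k + 4)} (hab : a ≠ b) {s : ℕ}
    {e e' : ℕ → Bool × Bool} (hD : IsSwap a b (letD k s) (letD k s))
    (hL : ∀ i ≤ k, IsSwap a b (letL k i (e i)) (letL k i (e' i))) (hs : s ≤ k + 1) :
    W (wordD k s e') = -W (wordD k s e) := by
  have h : ∀ p, IsSwap a b (wordD k s e p) (wordD k s e' p) := fun p => by
    rw [wordD, wordD]
    rcases lt_trichotomy p.val s with h | h | h
    · rw [insWord_of_lt h, insWord_of_lt h]
      exact hL p (by omega)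
    · rw [h, insWord_self, insWord_self]
      exact hD
    · obtain ⟨q, hq⟩ : ∃ q, p.val = q + 1 := ⟨p - 1, by omega⟩
      rw [hq, insWord_of_gt (by omega), insWord_of_gt (by omega)]
      exact hL q (by omega)
  exact hW.eq_neg hab (fun p => (h p).1) (fun p => (h p).2.1) fun p => (h p).2.2

theorem IsAlt.wordD_succ_right (hW : IsAlt W) {i s : ℕ} (hi : i < s) (hs : s ≤ k + 1)
    (x : ℕ → Bool) :
    W (wordD k s fun j => (x j, decide (j < i + 1))) =
      -W (wordD k s fun j => (x j, decide (j < i))) := by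
  refine hW.wordD_eq_neg (a := ⟨i + k + 1, by omega⟩) (b := ⟨2 * k + 2, by omega⟩)
    (by simp; omega) ?_ (fun j hj => ?_) hs <;>
  simp only [IsSwap, letL, letD, Set.mem_ofPred_eq, ne_eq, Fin.ext_iff, Fin.forall_iff] 
  · grind
  · grind

theorem IsAlt.wordD_succ_left (hW : IsAlt W) {i s : ℕ} (hi : i < s) (hs : s ≤ k + 1)
    (y : ℕ → Bool) :
    W (wordD k s fun j => (decide (i + 1 ≤ j), y j)) =
      -W (wordD k s fun j => (decide (i ≤ j), y j)) := by
  refine hW.wordD_eq_neg (a := ⟨i, by omega⟩) (b := ⟨2 * k + 3, by omega⟩)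
    (by simp; omega) ?_ (fun j hj => ?_) hs <;>
  simp only [IsSwap, letL, letD, Set.mem_ofPred_eq, ne_eq, Fin.ext_iff, Fin.forall_iff] <;> grind

theorem IsAlt.wordD_succ_eq_neg (hW : IsAlt W) {a b : Fin (2 * k + 4)} (hab : a ≠ b) {s : ℕ}
    {e e' : ℕ → Bool × Bool} (h1 : IsSwap a b (letD k s) (letL k s (e' s)))
    (h2 : IsSwap a b (letL k s (e s)) (letD k (s + 1)))
    (hL : ∀ i ≤ k, i ≠ s → IsSwap a b (letL k i (e i)) (letL k i (e' i))) (hs : s ≤ k) :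
    W (wordD k (s + 1) e') = -W (wordD k s e) := by
  have h : ∀ p, IsSwap a b (wordD k s e p) (wordD k (s + 1) e' p) := fun p => by
    rw [wordD, wordD]
    rcases lt_trichotomy p.val s with h | h | h
    · rw [insWord_of_lt h, insWord_of_lt (by omega)]
      exact hL p (by omega) h.ne
    · rw [h, insWord_self, insWord_of_lt (by omega)]
      exact h1
    · obtain ⟨q, hq⟩ : ∃ q, p.val = q + 1 := ⟨p - 1, by omega⟩
      rw [hq, insWord_of_gt (by omega)]
      rcases eq_or_ne q s with rfl | hqs
      · rw [insWord_self]
        exact h2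
      · rw [insWord_of_gt (by omega)]
        exact hL q (by omega) hqs
  exact hW.eq_neg hab (fun p => (h p).1) (fun p => (h p).2.1) fun p => (h p).2.2

theorem IsAlt.wordD_succ_lt (hW : IsAlt W) {s : ℕ} (hs : s ≤ k) :
    W (wordD k (s + 1) fun j => (decide (j < s + 1), decide (j < s))) =
      -W (wordD k s fun j => (decide (j < s), decide (j < s))) := by
  refine hW.wordD_succ_eq_neg (a := ⟨s + k + 1, by omega⟩) (b := ⟨2 * k + 3, by omega⟩)
    (by simp; omega) ?_ ?_ (fun j hj => ?_) hs <;>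
  simp only [IsSwap, letL, letD, Set.mem_ofPred_eq, ne_eq, Fin.ext_iff, Fin.forall_iff] <;> grind

theorem IsAlt.wordD_succ_le (hW : IsAlt W) {s : ℕ} (hs : s ≤ k) :
    W (wordD k (s + 1) fun j => (decide (s ≤ j), decide (s + 1 ≤ j))) =
      -W (wordD k s fun j => (decide (s ≤ j), decide (s ≤ j))) := by
  refine hW.wordD_succ_eq_neg (a := ⟨s, by omega⟩) (b := ⟨2 * k + 2, by omega⟩)
    (by simp; omega) ?_ ?_ (fun j hj => ?_) hs <;>
  simp only [IsSwap, letL, letD, Set.mem_ofPred_eq, ne_eq, Fin.ext_iff, Fin.forall_iff] <;> grind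

theorem wordD_congr {s : ℕ} {e e' : ℕ → Bool × Bool} (hs : s ≤ k + 1)
    (h : ∀ i ≤ k, e i = e' i) : wordD k s e = wordD k s e' := by
  funext p
  rw [wordD, wordD]
  rcases lt_trichotomy p.val s with hp | hp | hp
  · rw [insWord_of_lt hp, insWord_of_lt hp, h p (by omega)]
  · rw [hp, insWord_self, insWord_self]
  · obtain ⟨q, hq⟩ : ∃ q, p.val = q + 1 := ⟨p - 1, by omega⟩
    rw [hq, insWord_of_gt (by omega), insWord_of_gt (by omega), h q (by omega)]

theorem IsAlt.wordD_eq_zero [Module ℚ V] (hW : IsAlt W) {a b : Fin (2 * k + 4)} (hab : a ≠ b)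
    {s : ℕ} {e : ℕ → Bool × Bool} (hD : a ∈ letD k s ↔ b ∈ letD k s)
    (hL : ∀ i ≤ k, a ∈ letL k i (e i) ↔ b ∈ letL k i (e i)) (hs : s ≤ k + 1) :
    W (wordD k s e) = 0 := by
  refine hW.eq_zero hab fun p => ?_
  rw [wordD]
  rcases lt_trichotomy p.val s with h | h | h
  · rw [insWord_of_lt h]
    exact hL p (by omega)
  · rw [h, insWord_self]
    exact hD
  · obtain ⟨q, hq⟩ : ∃ q, p.val = q + 1 := ⟨p - 1, by omega⟩
    rw [hq, insWord_of_gt (by omega)]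
    exact hL q (by omega)

section Vanishing

variable [Module ℚ V] {s : ℕ} {e : ℕ → Bool × Bool}

theorem IsAlt.fst_succ (hW : IsAlt W) (hs : s ≤ k + 1) (h0 : W (wordD k s e) ≠ 0) {i : ℕ}
    (hi : i < k) (his : i + 1 ≠ s) (h : (e i).1 = true) : (e (i + 1)).1 = true := by
  by_contra h'
  refine h0 (hW.wordD_eq_zero (a := ⟨i, by omega⟩) (b := ⟨i + 1, by omega⟩)
    (by simp) ?_ (fun j hj => ?_) hs) <;>
  simp only [letL, letD, Set.mem_ofPred_eq] <;> grind

theorem IsAlt.snd_of_succ (hW : IsAlt W) (hs : s ≤ k + 1) (h0 : W (wordD k s e) ≠ 0) {i : ℕ}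
    (hi : i < k) (his : i + 1 ≠ s) (h : (e (i + 1)).2 = true) : (e i).2 = true := by
  by_contra h'
  refine h0 (hW.wordD_eq_zero (a := ⟨i + k + 1, by omega⟩) (b := ⟨i + k + 2, by omega⟩)
    (by simp) ?_ (fun j hj => ?_) hs) <;>
  simp only [letL, letD, Set.mem_ofPred_eq] <;> grind

theorem IsAlt.snd_zero (hW : IsAlt W) (hs : s ≤ k) (hs0 : 0 < s) (h0 : W (wordD k s e) ≠ 0)
    (h : (e k).1 = true) : (e 0).2 = false := by
  by_contra h'
  refine h0 (hW.wordD_eq_zero (a := ⟨k, by omega⟩) (b := ⟨k + 1, by omega⟩)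
    (by simp) ?_ (fun j hj => ?_) (by omega)) <;>
  simp only [letL, letD, Set.mem_ofPred_eq] <;> grind

theorem IsAlt.fst_zero (hW : IsAlt W) (hs : s ≤ k) (hs0 : 0 < s) (h0 : W (wordD k s e) ≠ 0)
    (h : (e k).2 = false) : (e 0).1 = true := by
  by_contra h'
  refine h0 (hW.wordD_eq_zero (a := ⟨2 * k + 1, by omega⟩) (b := ⟨0, by omega⟩)
    (by simp) ?_ (fun j hj => ?_) (by omega)) <;>
  simp only [letL, letD, Set.mem_ofPred_eq] <;> grind

theorem IsAlt.fst_last (hW : IsAlt W) (hs : s ≤ k) (h0 : W (wordD k s e) ≠ 0)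
    (h : ∀ i ≤ k, (e i).2 = false) : (e k).1 = false := by
  by_contra h'
  refine h0 (hW.wordD_eq_zero (a := ⟨2 * k + 2, by omega⟩) (b := ⟨k, by omega⟩)
    (by simp; omega) ?_ (fun j hj => ?_) (by omega)) <;>
  simp only [letL, letD, Set.mem_ofPred_eq] <;> grind

theorem IsAlt.snd_last (hW : IsAlt W) (hs : s ≤ k) (h0 : W (wordD k s e) ≠ 0)
    (h : ∀ i ≤ k, (e i).1 = true) : (e k).2 = true := by
  by_contra h'
  refine h0 (hW.wordD_eq_zero (a := ⟨2 * k + 3, by omega⟩) (b := ⟨2 * k + 1, by omega⟩)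
    (by simp) ?_ (fun j hj => ?_) (by omega)) <;>
  simp only [letL, letD, Set.mem_ofPred_eq] <;> grind

theorem exists_eq_decide_lt {y : ℕ → Bool} {l : ℕ}
    (h : ∀ i, i + 1 < l → y (i + 1) = true → y i = true) :
    ∃ a ≤ l, ∀ i < l, y i = decide (i < a) := by
  induction l with
  | zero => exact ⟨0, le_rfl, by simp⟩
  | succ l ih =>
    obtain ⟨a, ha, hy⟩ := ih fun i hi => h i (by omega)
    rcases hl : y l with _ | _
    · exact ⟨a, by omega, fun i hi => by grind⟩
    · refine ⟨l + 1, le_rfl, fun i hi => ?_⟩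
      rcases Nat.eq_zero_or_pos l with rfl | hl0
      · grind
      · have := h (l - 1) (by omega) (by rwa [Nat.sub_add_cancel hl0])
        grind

theorem exists_eq_decide_le {y : ℕ → Bool} {l : ℕ}
    (h : ∀ i, i + 1 < l → y i = true → y (i + 1) = true) :
    ∃ a ≤ l, ∀ i < l, y i = decide (a ≤ i) := by
  obtain ⟨a, ha, hy⟩ := exists_eq_decide_lt (y := fun i => !y i) (l := l) fun i hi hy => by
    have := h i hi
    grind
  exact ⟨a, ha, fun i hi => by grind⟩

theorem IsAlt.exists_of_last (hW : IsAlt W) (h0 : W (wordD k (k + 1) e) ≠ 0) :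
    ∃ a ≤ k + 1, ∃ b ≤ k + 1, ∀ i ≤ k, e i = (decide (a ≤ i), decide (i < b)) := by
  obtain ⟨a, ha, hx⟩ := exists_eq_decide_le (y := fun i => (e i).1) (l := k + 1) fun i hi =>
    hW.fst_succ le_rfl h0 (by omega) (by omega)
  obtain ⟨b, hb, hy⟩ := exists_eq_decide_lt (y := fun i => (e i).2) (l := k + 1) fun i hi =>
    hW.snd_of_succ le_rfl h0 (by omega) (by omega)
  exact ⟨a, ha, b, hb, fun i hi => Prod.ext (hx i (by omega)) (hy i (by omega))⟩

theorem IsAlt.fst_of_le (hW : IsAlt W) (hs : s ≤ k) (h0 : W (wordD k s e) ≠ 0) {i j : ℕ}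
    (hij : i ≤ j) (hj : j ≤ k) (h : s ≤ i ∨ j < s) (hi : (e i).1 = true) : (e j).1 = true := by
  induction j, hij using Nat.le_induction with
  | base => exact hi
  | succ j hij ih =>
    exact hW.fst_succ (by omega) h0 (by omega) (by omega) (ih (by omega) (by omega))

theorem IsAlt.snd_of_le (hW : IsAlt W) (hs : s ≤ k) (h0 : W (wordD k s e) ≠ 0) {i j : ℕ}
    (hij : i ≤ j) (hj : j ≤ k) (h : s ≤ i ∨ j < s) (hi : (e j).2 = true) : (e i).2 = true := by
  induction j, hij using Nat.le_induction with
  | base => exact hi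
  | succ j hij ih =>
    exact ih (by omega) (by omega) (hW.snd_of_succ (by omega) h0 (by omega) (by omega) hi)

theorem IsAlt.exists_of_le (hW : IsAlt W) (hs : s ≤ k) (h0 : W (wordD k s e) ≠ 0)
    (he : e s ≠ (false, true)) :
    ∃ a ≤ s, (∀ i ≤ k, e i = (decide (i < s), decide (i < a))) ∨
      ∀ i ≤ k, e i = (decide (a ≤ i), decide (s ≤ i)) := by
  have hx := fun i j => hW.fst_of_le hs h0 (i := i) (j := j)
  have hy := fun i j => hW.snd_of_le hs h0 (i := i) (j := j)
  have h1 := fun h => hW.snd_zero hs h h0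
  have h2 := fun h => hW.fst_zero hs h h0
  have h3 := hW.fst_last hs h0
  have h4 := hW.snd_last hs h0
  obtain ⟨a, ha, hx'⟩ := exists_eq_decide_le (y := fun i => (e i).1) (l := s) fun i hi =>
    hx i (i + 1) (by omega) (by omega) (by omega)
  obtain ⟨b, hb, hy'⟩ := exists_eq_decide_lt (y := fun i => (e i).2) (l := s) fun i hi =>
    hy i (i + 1) (by omega) (by omega) (by omega)
  rcases hs1 : (e s).1 with _ | _
  · have hs2 : (e s).2 = false := by
      by_contra h
      exact he (Prod.ext hs1 (by simpa using h))
    have hy2 : ∀ i, s ≤ i → i ≤ k → (e i).2 = false := fun i hi hik => by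
      have := hy s i hi hik (Or.inl le_rfl)
      grind
    have hx1 : ∀ i < s, (e i).1 = true := fun i hi =>
      hx 0 i (by omega) (by omega) (Or.inr hi) (h2 (by omega) (hy2 k hs le_rfl))
    have hk : (e k).1 = false := by
      by_contra hk
      refine hk (h3 fun i hik => ?_)
      rcases lt_or_ge i s with hi | hi
      · have h5 := h1 (by omega) (by simpa using hk)
        have := hy 0 i (by omega) hik (Or.inr hi)
        grind
      · exact hy2 i hi hik
    refine ⟨b, hb, Or.inl fun i hik => Prod.ext ?_ ?_⟩
    · rcases lt_or_ge i s with hi | hi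
      · simp [hx1 i hi, hi]
      · have := hx i k hik le_rfl (Or.inl hi)
        grind
    · rcases lt_or_ge i s with hi | hi
      · exact hy' i hi
      · have := hy2 i hi hik
        grind
  · have hx1 : ∀ i, s ≤ i → i ≤ k → (e i).1 = true := fun i hi hik =>
      hx s i hi hik (Or.inl le_rfl) hs1
    have hy1 : ∀ i < s, (e i).2 = false := fun i hi => by
      have := hy 0 i (by omega) (by omega) (Or.inr hi)
      have := h1 (by omega) (hx1 k hs le_rfl)
      grind
    have hk : (e k).2 = true := by
      by_contra hk
      refine hk (h4 fun i hik => ?_)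
      rcases lt_or_ge i s with hi | hi
      · exact hx 0 i (by omega) hik (Or.inr hi) (h2 (by omega) (by simpa using hk))
      · exact hx1 i hi hik
    refine ⟨a, ha, Or.inr fun i hik => Prod.ext ?_ ?_⟩
    · rcases lt_or_ge i s with hi | hi
      · exact hx' i hi
      · have := hx1 i hi hik
        grind
    · rcases lt_or_ge i s with hi | hi
      · have := hy1 i hi
        grind
      · have := hy i k hik le_rfl (Or.inl hi) hk
        grind

end Vanishing

end Words

section SignedSum

variable {k : ℕ} {V : Type*} [AddCommGroup V] [Module ℚ V]
  {W : (Fin (k + 2) → Set (Fin (2 * k + 4))) → V}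

/-- The sign attached to an element of `Bool`. -/
def sg (b : Bool) : ℚ := if b then -1 else 1

/-- Extension of a finite sequence of pairs by `(false, false)`. -/
def ext (r : Fin (k + 1) → Bool × Bool) (i : ℕ) : Bool × Bool :=
  if h : i < k + 1 then r ⟨i, h⟩ else (false, false)

theorem ext_coe (r : Fin (k + 1) → Bool × Bool) (i : Fin (k + 1)) : ext r i = r i :=
  dif_pos i.isLt

theorem ext_restrict (e : ℕ → Bool × Bool) {i : ℕ} (hi : i ≤ k) :
    ext (fun j : Fin (k + 1) => e j) i = e i :=
  dif_pos (by omega)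

theorem eq_restrict {r : Fin (k + 1) → Bool × Bool} {e : ℕ → Bool × Bool}
    (h : ∀ i ≤ k, ext r i = e i) : r = fun j : Fin (k + 1) => e j := by
  funext j
  exact (ext_coe r j).symm.trans (h j (by omega))

/-- The coefficient of the word with choices `r`. -/
def coef (r : Fin (k + 1) → Bool × Bool) : ℚ := ∏ i, sg (r i).1 * sg (r i).2

theorem prod_sg_lt {a n : ℕ} (ha : a ≤ n) : ∏ i : Fin n, sg (decide (i.val < a)) = (-1) ^ a := by
  rw [Fin.prod_univ_eq_prod_range fun i => sg (decide (i < a))]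
  induction n, ha using Nat.le_induction with
  | base =>
    rw [Finset.prod_congr rfl fun i hi => by rw [decide_eq_true (Finset.mem_range.mp hi)]]
    simp [sg]
  | succ n hn ih => rw [Finset.prod_range_succ, ih]; simp [sg, hn]

theorem prod_sg_le {a n : ℕ} (ha : a ≤ n) :
    ∏ i : Fin n, sg (decide (a ≤ i.val)) = (-1) ^ (n + a) := by
  have h : ∀ i : Fin n, sg (decide (a ≤ i.val)) = -1 * sg (decide (i.val < a)) := fun i => by
    simp only [sg, decide_eq_true_eq]
    grind
  simp_rw [h]
  rw [Finset.prod_mul_distrib, prod_sg_lt ha, pow_add]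
  simp

theorem IsAlt.pow_smul_right (hW : IsAlt W) {a s : ℕ} (ha : a ≤ s) (hs : s ≤ k + 1)
    (x : ℕ → Bool) :
    (-1 : ℚ) ^ a • W (wordD k s fun j => (x j, decide (j < a))) =
      W (wordD k s fun j => (x j, false)) := by
  induction a with
  | zero => simp
  | succ a ih =>
    rw [hW.wordD_succ_right (by omega) hs, ← ih (by omega), pow_succ]
    simp

theorem IsAlt.pow_smul_left (hW : IsAlt W) {a s : ℕ} (ha : a ≤ s) (hs : s ≤ k + 1)
    (y : ℕ → Bool) :
    (-1 : ℚ) ^ a • W (wordD k s fun j => (decide (a ≤ j), y j)) =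
      W (wordD k s fun j => (true, y j)) := by
  induction a with
  | zero => simp
  | succ a ih =>
    rw [hW.wordD_succ_left (by omega) hs, ← ih (by omega), pow_succ]
    simp

theorem IsAlt.pow_smul_lt (hW : IsAlt W) {s : ℕ} (hs : s ≤ k + 1) :
    (-1 : ℚ) ^ s • W (wordD k s fun j => (decide (j < s), false)) =
      W (wordD k 0 fun _ => (false, false)) := by
  induction s with
  | zero => simp
  | succ s ih =>
    have h1 := hW.pow_smul_right (Nat.le_succ s) hs fun j => decide (j < s + 1)
    have h2 := hW.pow_smul_right le_rfl (by omega : s ≤ k + 1) fun j => decide (j < s)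
    rw [hW.wordD_succ_lt (by omega), smul_neg, h2] at h1
    rw [← ih (by omega), ← h1, pow_succ]
    simp

theorem IsAlt.pow_smul_le (hW : IsAlt W) {s : ℕ} (hs : s ≤ k + 1) :
    (-1 : ℚ) ^ s • W (wordD k s fun j => (true, decide (s ≤ j))) =
      W (wordD k 0 fun _ => (true, true)) := by
  induction s with
  | zero => simp
  | succ s ih =>
    have h1 := hW.pow_smul_left (Nat.le_succ s) hs fun j => decide (s + 1 ≤ j)
    have h2 := hW.pow_smul_left le_rfl (by omega : s ≤ k + 1) fun j => decide (s ≤ j)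
    rw [hW.wordD_succ_le (by omega), smul_neg, h2] at h1
    rw [← ih (by omega), ← h1, pow_succ]
    simp

variable (W) in
/-- The common value, up to sign, of `W` on the words that do not cancel. -/
def base : V := W (wordD k (k + 1) fun _ => (true, true))

theorem IsAlt.last_eq (hW : IsAlt W) {a b : ℕ} (ha : a ≤ k + 1) (hb : b ≤ k + 1) :
    (-1 : ℚ) ^ (k + 1 + a + b) •
      W (wordD k (k + 1) fun j => (decide (a ≤ j), decide (j < b))) = base W := by
  have h : ∀ a b, a ≤ k + 1 → b ≤ k + 1 → (-1 : ℚ) ^ (a + b) •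
      W (wordD k (k + 1) fun j => (decide (a ≤ j), decide (j < b))) =
        W (wordD k (k + 1) fun _ => (true, false)) := fun a b ha hb => by
    rw [pow_add, mul_smul, hW.pow_smul_right hb le_rfl, hW.pow_smul_left ha le_rfl fun _ => false]
  have h1 := h 0 (k + 1) (by omega) le_rfl
  rw [wordD_congr (e' := fun _ => (true, true)) le_rfl fun i hi => by simp; omega] at h1
  rw [add_assoc, pow_add, mul_smul, h a b ha hb, ← h1, zero_add, ← mul_smul, ← mul_pow]
  simp [base]

theorem IsAlt.lt_eq (hW : IsAlt W) {a s : ℕ} (ha : a ≤ s) (hs : s ≤ k + 1) :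
    (-1 : ℚ) ^ (s + a) • W (wordD k s fun j => (decide (j < s), decide (j < a))) = base W := by
  rw [pow_add, mul_smul, hW.pow_smul_right ha hs, hW.pow_smul_lt hs, ← hW.pow_smul_lt le_rfl,
    ← hW.last_eq (a := 0) (b := 0) (by omega) (by omega)]
  congr 2
  exact wordD_congr le_rfl fun i hi => by simp; omega

theorem IsAlt.le_eq (hW : IsAlt W) {a s : ℕ} (ha : a ≤ s) (hs : s ≤ k + 1) :
    (-1 : ℚ) ^ (s + a) • W (wordD k s fun j => (decide (a ≤ j), decide (s ≤ j))) = base W := by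
  rw [pow_add, mul_smul, hW.pow_smul_left ha hs, hW.pow_smul_le hs, ← hW.pow_smul_le le_rfl,
    ← hW.last_eq (a := 0) (b := 0) (by omega) (by omega)]
  congr 2
  exact wordD_congr le_rfl fun i hi => by simp; omega

variable (W) in
/-- The signed sum over the words `wordD k s` that are not words `wordE k (s + 1)`. -/
def sumD (s : ℕ) : V := ∑ r : Fin (k + 1) → Bool × Bool,
  if ext r s = (false, true) then 0 else coef r • W (wordD k s (ext r))

theorem IsAlt.sumD_of_le (hW : IsAlt W) {s : ℕ} (hs : s ≤ k) :
    sumD W s = (2 * (s + 1) : ℕ) • base W := by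
  let f1 : ℕ → Fin (k + 1) → Bool × Bool := fun a j => (decide (j.val < s), decide (j.val < a))
  let f2 : ℕ → Fin (k + 1) → Bool × Bool := fun a j => (decide (a ≤ j.val), decide (s ≤ j.val))
  have hi1 : Set.InjOn f1 (Finset.range (s + 1)) := fun a ha b hb h => by
    by_contra hab
    simp only [Finset.coe_range, Set.mem_Iio] at ha hb
    have := congrFun h ⟨min a b, by omega⟩
    simp only [f1, Prod.mk.injEq, decide_eq_decide] at this
    omega
  have hi2 : Set.InjOn f2 (Finset.range (s + 1)) := fun a ha b hb h => by
    by_contra hab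
    simp only [Finset.coe_range, Set.mem_Iio] at ha hb
    have := congrFun h ⟨min a b, by omega⟩
    simp only [f2, Prod.mk.injEq, decide_eq_decide] at this
    omega
  have hd : Disjoint ((Finset.range (s + 1)).image f1) ((Finset.range (s + 1)).image f2) := by
    rw [Finset.disjoint_left]
    rintro r h1 h2
    obtain ⟨a, ha, rfl⟩ := Finset.mem_image.mp h1
    obtain ⟨b, hb, h⟩ := Finset.mem_image.mp h2
    have := congrFun h ⟨s, by omega⟩
    simp only [f1, f2, Prod.mk.injEq, decide_eq_decide, Finset.mem_range] at this ha hb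
    omega
  rw [sumD, ← Finset.sum_subset (Finset.subset_univ
    ((Finset.range (s + 1)).image f1 ∪ (Finset.range (s + 1)).image f2)),
    Finset.sum_eq_card_nsmul (b := base W), Finset.card_union_of_disjoint hd,
    Finset.card_image_of_injOn hi1, Finset.card_image_of_injOn hi2, Finset.card_range, two_mul]
  · intro r hr
    rcases Finset.mem_union.mp hr with hr | hr
    · obtain ⟨a, ha, rfl⟩ := Finset.mem_image.mp hr
      have ha' := Finset.mem_range.mp ha
      rw [if_neg (by
        rw [ext_restrict (fun j => (decide (j < s), decide (j < a))) hs]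
        simp; omega), ← hW.lt_eq (a := a) (by omega) (by omega : s ≤ k + 1)]
      congr 1
      · rw [coef, Finset.prod_mul_distrib, prod_sg_lt (by omega), prod_sg_lt (by omega), pow_add]
      · exact congrArg W (wordD_congr (by omega) fun i hi =>
          ext_restrict (fun j => (decide (j < s), decide (j < a))) hi)
    · obtain ⟨a, ha, rfl⟩ := Finset.mem_image.mp hr
      have ha' := Finset.mem_range.mp ha
      rw [if_neg (by
        rw [ext_restrict (fun j => (decide (a ≤ j), decide (s ≤ j))) hs]
        simp; omega), ← hW.le_eq (a := a) (by omega) (by omega : s ≤ k + 1)]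
      congr 1
      · rw [coef, Finset.prod_mul_distrib, prod_sg_le (by omega), prod_sg_le (by omega), ← pow_add,
          show k + 1 + a + (k + 1 + s) = s + a + 2 * (k + 1) by ring, pow_add, pow_mul]
        simp
      · exact congrArg W (wordD_congr (by omega) fun i hi =>
          ext_restrict (fun j => (decide (a ≤ j), decide (s ≤ j))) hi)
  · intro r _ hr
    split_ifs with h
    · rfl
    by_contra h0
    obtain ⟨a, ha, h1 | h1⟩ := hW.exists_of_le hs (right_ne_zero_of_smul h0) h
    · exact hr (Finset.mem_union_left _ (Finset.mem_image.mpr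
        ⟨a, Finset.mem_range.mpr (by omega), (eq_restrict h1).symm⟩))
    · exact hr (Finset.mem_union_right _ (Finset.mem_image.mpr
        ⟨a, Finset.mem_range.mpr (by omega), (eq_restrict h1).symm⟩))

theorem IsAlt.sumD_last (hW : IsAlt W) : sumD W (k + 1) = ((k + 2) * (k + 2) : ℕ) • base W := by
  let f : ℕ × ℕ → Fin (k + 1) → Bool × Bool :=
    fun a j => (decide (a.1 ≤ j.val), decide (j.val < a.2))
  have hi : Set.InjOn f ((Finset.range (k + 2) ×ˢ Finset.range (k + 2) : Finset _)) := by
    rintro ⟨a, b⟩ ha ⟨c, d⟩ hc h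
    simp only [Finset.coe_product, Finset.coe_range, Set.mem_prod, Set.mem_Iio] at ha hc
    have h1 : a = c := by
      by_contra hab
      have := congrFun h ⟨min a c, by omega⟩
      simp only [f, Prod.mk.injEq, decide_eq_decide] at this
      omega
    have h2 : b = d := by
      by_contra hab
      have := congrFun h ⟨min b d, by omega⟩
      simp only [f, Prod.mk.injEq, decide_eq_decide] at this
      omega
    rw [h1, h2]
  rw [sumD, ← Finset.sum_subset (Finset.subset_univ
    ((Finset.range (k + 2) ×ˢ Finset.range (k + 2)).image f)),
    Finset.sum_eq_card_nsmul (b := base W),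
    Finset.card_image_of_injOn hi, Finset.card_product, Finset.card_range]
  · intro r hr
    obtain ⟨⟨a, b⟩, ha, rfl⟩ := Finset.mem_image.mp hr
    obtain ⟨ha, hb⟩ := Finset.mem_product.mp ha
    simp only [Finset.mem_range] at ha hb
    rw [if_neg (by simp [ext]), ← hW.last_eq (a := a) (b := b) (by omega) (by omega)]
    congr 1
    · rw [coef, Finset.prod_mul_distrib, prod_sg_le (by omega), prod_sg_lt (by omega), ← pow_add]
    · exact congrArg W (wordD_congr (by omega) fun i hi =>
        ext_restrict (fun j => (decide (a ≤ j), decide (j < b))) hi)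
  · intro r _ hr
    rw [if_neg (by simp [ext])]
    by_contra h0
    obtain ⟨a, ha, b, hb, h1⟩ := hW.exists_of_last (right_ne_zero_of_smul h0)
    exact hr (Finset.mem_image.mpr ⟨(a, b), Finset.mem_product.mpr
      ⟨Finset.mem_range.mpr (by omega), Finset.mem_range.mpr (by omega)⟩, (eq_restrict h1).symm⟩)

theorem IsAlt.sum_sumD (hW : IsAlt W) :
    ∑ s ∈ Finset.range (k + 2), sumD W s = ((k + 2) * (2 * k + 3) : ℕ) • base W := by
  have h : ∀ n ≤ k + 1, ∑ s ∈ Finset.range n, sumD W s = (n * (n + 1) : ℕ) • base W := by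
    intro n hn
    induction n with
    | zero => simp
    | succ n ih =>
      rw [Finset.sum_range_succ, ih (by omega), hW.sumD_of_le (by omega), ← add_nsmul]
      congr 1
      ring
  rw [Finset.sum_range_succ, h _ le_rfl, hW.sumD_last, ← add_nsmul]
  congr 1
  ring

end SignedSum

section Difference

variable {k : ℕ} {V : Type*} [AddCommGroup V]
  {W : (Fin (k + 2) → Set (Fin (2 * k + 4))) → V}

/-- The reflection `v ↦ 2k + 1 - v` of the labels below `2k + 2`, exchanging the last two. -/
def flipLab (k : ℕ) : Equiv.Perm (Fin (2 * k + 4)) :=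
  Function.Involutive.toPerm
    (fun v => if h : v.val < 2 * k + 2 then ⟨2 * k + 1 - v.val, by omega⟩
      else ⟨4 * k + 5 - v.val, by omega⟩)
    (fun v => by
      grind)

theorem flipLab_val (v : Fin (2 * k + 4)) :
    (flipLab k v).val = if v.val < 2 * k + 2 then 2 * k + 1 - v.val else 4 * k + 5 - v.val := by
  change (if h : v.val < 2 * k + 2 then (⟨2 * k + 1 - v.val, by omega⟩ : Fin (2 * k + 4))
    else ⟨4 * k + 5 - v.val, by omega⟩).val = _
  split_ifs <;> rfl

/-- The function of words obtained from `W` by reversing words and flipping labels. -/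
def flipFun (W : (Fin (k + 2) → Set (Fin (2 * k + 4))) → V)
    (M : Fin (k + 2) → Set (Fin (2 * k + 4))) : V :=
  W fun p => flipLab k ⁻¹' M p.rev

theorem IsAlt.flipFun (hW : IsAlt W) : IsAlt (flipFun W) := fun a b hab M => by
  rw [GrassPoly.flipFun, GrassPoly.flipFun,
    ← hW ((flipLab k).symm a) ((flipLab k).symm b) (by simpa using hab)]
  congr 1
  funext p
  rw [← Set.preimage_comp, ← Set.preimage_comp]
  congr 1
  funext v
  have h := Equiv.swap_apply_apply (flipLab k) ((flipLab k).symm a) ((flipLab k).symm b)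
  rw [Equiv.apply_symm_apply, Equiv.apply_symm_apply] at h
  simp [h]

/-- Reversal of a sequence of pairs, swapping the entries. -/
def flipSeq (k : ℕ) : (Fin (k + 1) → Bool × Bool) ≃ (Fin (k + 1) → Bool × Bool) :=
  Function.Involutive.toPerm (fun r i => (r i.rev).swap) fun r => by
    funext i
    simp

theorem flipSeq_apply (r : Fin (k + 1) → Bool × Bool) (i : Fin (k + 1)) :
    flipSeq k r i = (r i.rev).swap := rfl

theorem ext_flipSeq (r : Fin (k + 1) → Bool × Bool) {i : ℕ} (hi : i ≤ k) :
    ext (flipSeq k r) i = (ext r (k - i)).swap := by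
  have h : (⟨i, by omega⟩ : Fin (k + 1)).rev = ⟨k - i, by omega⟩ := Fin.ext (by simp [Fin.rev])
  rw [ext, dif_pos (by omega), flipSeq_apply, h, ext, dif_pos (by omega)]

theorem coef_flipSeq (r : Fin (k + 1) → Bool × Bool) : coef (flipSeq k r) = coef r := by
  rw [coef, coef]
  refine Fintype.prod_equiv Fin.revPerm _ _ fun i => ?_
  rw [flipSeq_apply, mul_comm]
  rfl

theorem preimage_letL {i : ℕ} (hi : i ≤ k) (e : Bool × Bool) :
    flipLab k ⁻¹' letL k (k - i) e.swap = letL k i e := by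
  ext v
  rw [Set.mem_preimage]
  simp only [letL, Set.mem_ofPred_eq, flipLab_val, Prod.fst_swap, Prod.snd_swap]
  have := v.isLt
  grind

theorem preimage_letD {s : ℕ} (hs : s ≤ k + 1) :
    flipLab k ⁻¹' letD k (k + 1 - s) = letE k s := by
  ext v
  rw [Set.mem_preimage]
  simp only [letD, letE, Set.mem_ofPred_eq, flipLab_val]
  have := v.isLt
  grind

theorem preimage_wordD {s : ℕ} (hs : s ≤ k + 1) (r : Fin (k + 1) → Bool × Bool)
    (p : Fin (k + 2)) :
    flipLab k ⁻¹' wordD k (k + 1 - s) (ext (flipSeq k r)) p.rev = wordE k s (ext r) p := by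
  have hp : p.rev.val = k + 1 - p := by simp [Fin.rev]
  rw [wordD, wordE, hp]
  rcases lt_trichotomy p.val s with h | h | h
  · rw [insWord_of_lt h, show k + 1 - p.val = k - p + 1 by omega, insWord_of_gt (by omega),
      ext_flipSeq r (by omega), show k - (k - p.val) = p by omega, preimage_letL (by omega)]
  · rw [h, insWord_self, insWord_self, preimage_letD hs]
  · obtain ⟨q, hq⟩ : ∃ q, p.val = q + 1 := ⟨p - 1, by omega⟩
    rw [hq, insWord_of_gt (by omega), show k + 1 - (q + 1) = k - q by omega,
      insWord_of_lt (by omega), ext_flipSeq r (by omega), show k - (k - q) = q by omega,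
      preimage_letL (by omega)]

theorem sumD_flipFun [Module ℚ V] {s : ℕ} (hs : s ≤ k + 1) :
    sumD (flipFun W) (k + 1 - s) = ∑ r : Fin (k + 1) → Bool × Bool,
      if ext (flipSeq k r) (k + 1 - s) = (false, true) then 0
      else coef r • W (wordE k s (ext r)) := by
  rw [sumD]
  refine (Fintype.sum_equiv (flipSeq k) _ _ fun r => ?_).symm
  rw [coef_flipSeq, flipFun]
  simp_rw [preimage_wordD hs]

/-- Exchange of the two entries of the term with index `s`. -/
def swapAt (s : Fin (k + 1)) : (Fin (k + 1) → Bool × Bool) ≃ (Fin (k + 1) → Bool × Bool) :=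
  Function.Involutive.toPerm (fun r i => if i = s then (r i).swap else r i) fun r => by
    funext i
    by_cases h : i = s <;> simp [h]

theorem swapAt_apply (s : Fin (k + 1)) (r : Fin (k + 1) → Bool × Bool) (i : Fin (k + 1)) :
    swapAt s r i = if i = s then (r i).swap else r i := rfl

theorem coef_swapAt (s : Fin (k + 1)) (r : Fin (k + 1) → Bool × Bool) :
    coef (swapAt s r) = coef r := by
  rw [coef, coef]
  refine Finset.prod_congr rfl fun i _ => ?_
  rw [swapAt_apply]
  split_ifs
  · exact mul_comm _ _
  · rfl

theorem wordE_swapAt {s : ℕ} (hs : s < k + 1) {r : Fin (k + 1) → Bool × Bool}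
    (h : ext r s = (false, true)) :
    wordE k (s + 1) (ext (swapAt ⟨s, hs⟩ r)) = wordD k s (ext r) := by
  have h1 : ext (swapAt ⟨s, hs⟩ r) s = (true, false) := by
    have h2 := (ext_coe r ⟨s, hs⟩).symm.trans h
    exact (ext_coe (swapAt ⟨s, hs⟩ r) ⟨s, hs⟩).trans (by rw [swapAt_apply, if_pos rfl, h2]; rfl)
  have h2 : ∀ i ≠ s, ext (swapAt ⟨s, hs⟩ r) i = ext r i := fun i hi => by
    rw [ext, ext]
    split_ifs
    · rw [swapAt_apply, if_neg (by simpa using hi)]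
    · rfl
  funext p
  rw [wordD, wordE]
  rcases lt_trichotomy p.val s with hp | hp | hp
  · rw [insWord_of_lt hp, insWord_of_lt (by omega), h2 _ hp.ne]
  · rw [hp, insWord_self, insWord_of_lt (by omega), h1]
    ext v
    simp only [letL, letD, Set.mem_ofPred_eq]
    grind
  · obtain ⟨q, hq⟩ : ∃ q, p.val = q + 1 := ⟨p - 1, by omega⟩
    rw [hq, insWord_of_gt (q := s) (by omega)]
    rcases eq_or_ne q s with rfl | hqs
    · rw [insWord_self, h]
      ext v
      simp only [letL, letE, Set.mem_ofPred_eq]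
      grind
    · rw [insWord_of_gt (by omega), h2 q hqs]

variable (W) in
theorem sum_word_sub [Module ℚ V] : ∑ s ∈ Finset.range (k + 2), ∑ r : Fin (k + 1) → Bool × Bool,
      coef r • (W (wordD k s (ext r)) - W (wordE k s (ext r))) =
    ∑ s ∈ Finset.range (k + 2), sumD W s - ∑ s ∈ Finset.range (k + 2), sumD (flipFun W) s := by
  let BD : ℕ → V := fun s => ∑ r : Fin (k + 1) → Bool × Bool,
    if ext r s = (false, true) then coef r • W (wordD k s (ext r)) else 0
  let BE : ℕ → V := fun s => ∑ r : Fin (k + 1) → Bool × Bool,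
    if ext (flipSeq k r) (k + 1 - s) = (false, true) then coef r • W (wordE k s (ext r)) else 0
  have hD : ∀ s, ∑ r : Fin (k + 1) → Bool × Bool, coef r • W (wordD k s (ext r)) =
      sumD W s + BD s := fun s => by
    rw [sumD, ← Finset.sum_add_distrib]
    refine Finset.sum_congr rfl fun r _ => ?_
    split_ifs <;> simp
  have hE : ∀ s ≤ k + 1, ∑ r : Fin (k + 1) → Bool × Bool, coef r • W (wordE k s (ext r)) =
      sumD (flipFun W) (k + 1 - s) + BE s := fun s hs => by
    rw [sumD_flipFun hs, ← Finset.sum_add_distrib]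
    refine Finset.sum_congr rfl fun r _ => ?_
    split_ifs <;> simp
  have hBD : BD (k + 1) = 0 := Finset.sum_eq_zero fun r _ => if_neg (by simp [ext])
  have hBE : BE 0 = 0 := Finset.sum_eq_zero fun r _ => if_neg (by simp [ext])
  have hB : ∀ s < k + 1, BE (s + 1) = BD s := fun s hs => by
    refine (Fintype.sum_equiv (swapAt ⟨s, hs⟩) _ _ fun r => ?_).symm
    have h : ext (flipSeq k (swapAt ⟨s, hs⟩ r)) (k + 1 - (s + 1)) = ext r s := by
      rw [ext_flipSeq _ (by omega), show k - (k + 1 - (s + 1)) = s by omega, ext, dif_pos hs,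
        swapAt_apply, if_pos rfl, Prod.swap_swap, ext, dif_pos hs]
    rw [h]
    by_cases h0 : ext r s = (false, true)
    · rw [if_pos h0, if_pos h0, coef_swapAt, wordE_swapAt hs h0]
    · rw [if_neg h0, if_neg h0]
  simp_rw [smul_sub, Finset.sum_sub_distrib]
  rw [Finset.sum_congr rfl fun s _ => hD s, Finset.sum_congr rfl fun s hs =>
    hE s (by have := Finset.mem_range.mp hs; omega), Finset.sum_add_distrib,
    Finset.sum_add_distrib, Finset.sum_range_succ BD, Finset.sum_range_succ' BE, hBD, hBE,
    Finset.sum_congr rfl fun s hs => hB s (Finset.mem_range.mp hs),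
    ← Finset.sum_range_reflect (sumD (flipFun W))]
  simp

theorem IsAlt.sum_word_sub [Module ℚ V] (hW : IsAlt W) :
    ∑ s ∈ Finset.range (k + 2), ∑ r : Fin (k + 1) → Bool × Bool,
      coef r • (W (wordD k s (ext r)) - W (wordE k s (ext r))) =
    ((k + 2) * (2 * k + 3) : ℕ) • (base W - base (GrassPoly.flipFun W)) := by
  rw [GrassPoly.sum_word_sub, hW.sum_sumD, hW.flipFun.sum_sumD, nsmul_sub]

end Difference

section Windows

/-- Skew-symmetrization of the tensor of the classes of a word of label sets. -/
noncomputable def altWord {N m n : ℕ} (M : Fin n → Set (Fin N)) : TP (FF N m) n :=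
  Alt (tprod ℚ fun p => clsSet m (M p))

theorem altWord_preimage {N m n : ℕ} (σ : Equiv.Perm (Fin N)) (M : Fin n → Set (Fin N)) :
    altWord (m := m) (fun p => σ ⁻¹' M p) =
      (((Equiv.Perm.sign σ : ℤˣ) : ℤ) : ℚ) • altWord (m := m) M := by
  rw [altWord, altWord, ← Equiv.Perm.sign_symm, ← Alt_tpMap, tpMap_tprod]
  simp only [vmap_clsSet, Equiv.image_symm_eq_preimage]

variable {k : ℕ}

/-- The function of words obtained from `altWord` by reversing words. -/
noncomputable def revAlt (k : ℕ) (M : Fin (k + 2) → Set (Fin (2 * k + 4))) :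
    TP (FF (2 * k + 4) (k + 2)) (k + 2) :=
  altWord fun p => M p.rev

theorem isAlt_revAlt : IsAlt (revAlt k) := fun a b hab M => by
  rw [revAlt, revAlt, altWord_preimage, Equiv.Perm.sign_swap hab]
  simp

/-- The `k + 2` consecutive labels starting at `p`. -/
def window (k p : ℕ) : Set (Fin (2 * k + 4)) := {v | p ≤ v.val ∧ v.val < p + k + 2}

theorem wordD_true : wordD k (k + 1) (fun _ => (true, true)) =
    fun p : Fin (k + 2) => window k p := by
  funext p
  rw [wordD]
  rcases Nat.lt_or_ge p.val (k + 1) with h | h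
  · rw [insWord_of_lt h]
    ext v
    simp only [letL, window, Set.mem_ofPred_eq]
    grind
  · rw [show p.val = k + 1 by omega, insWord_self]
    ext v
    simp only [letD, window, Set.mem_ofPred_eq]
    grind

theorem finRotate_val (v : Fin (2 * k + 4)) :
    (finRotate (2 * k + 4) v).val = if v.val = 2 * k + 3 then 0 else v.val + 1 := by
  rw [coe_finRotate]
  simp [Fin.ext_iff]

theorem sign_revPerm (j : ℕ) :
    Equiv.Perm.sign (Fin.revPerm : Equiv.Perm (Fin (2 * (j + 1)))) = (-1) ^ (j + 1) := by
  have h1 : orderOf (Fin.revPerm : Equiv.Perm (Fin (2 * (j + 1)))) = 2 := by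
    refine orderOf_eq_prime (by ext; simp [pow_two]) fun h => ?_
    have := congrArg Fin.val (Equiv.congr_fun h ⟨0, by omega⟩)
    simp at this
  obtain ⟨n, hn⟩ := Equiv.Perm.cycleType_prime_order (h1 ▸ Nat.prime_two)
  have h2 : (Fin.revPerm : Equiv.Perm (Fin (2 * (j + 1)))).support = Finset.univ := by
    ext v
    simp [Fin.ext_iff, Fin.val_rev]
    omega
  have h3 := Equiv.Perm.sum_cycleType (Fin.revPerm : Equiv.Perm (Fin (2 * (j + 1))))
  rw [hn, h2, h1] at h3
  simp at h3
  rw [Equiv.Perm.sign_of_cycleType, hn, h1, show n = j by omega]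
  simp [pow_add, pow_mul]

theorem base_revAlt :
    base (revAlt k) = (-1 : ℚ) ^ (k + 1) • altWord fun p : Fin (k + 2) => window k p := by
  have h : ∀ p : Fin (k + 2), window k p.rev =
      finRotate (2 * k + 4) ⁻¹' (Fin.revPerm ⁻¹' window k p) := fun p => by
    ext v
    simp only [window, Set.mem_preimage, Set.mem_ofPred_eq, Fin.revPerm_apply, Fin.val_rev,
      finRotate_val]
    grind
  have hs : Equiv.Perm.sign (Fin.revPerm : Equiv.Perm (Fin (2 * k + 4))) = (-1) ^ (k + 2) :=
    sign_revPerm (k + 1)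
  rw [base, wordD_true, revAlt]
  simp only [h]
  rw [altWord_preimage (finRotate (2 * k + 4)), altWord_preimage Fin.revPerm, sign_finRotate, hs,
    smul_smul]
  congr 1
  simp [pow_add, pow_mul]

theorem base_flipFun_revAlt : base (flipFun (revAlt k)) = -base (revAlt k) := by
  have h : ∀ p : Fin (k + 2), flipLab k ⁻¹' window k p.rev =
      finRotate (2 * k + 4) ⁻¹' window k p := fun p => by
    ext v
    simp only [window, Set.mem_preimage, Set.mem_ofPred_eq, flipLab_val, Fin.val_rev, finRotate_val]
    grind
  rw [base, base, wordD_true, flipFun]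
  simp only [h]
  rw [revAlt, altWord_preimage (finRotate (2 * k + 4)) fun p : Fin (k + 2) => window k p.rev,
    sign_finRotate]
  simp [pow_add, pow_mul, revAlt]

theorem sum_revAlt :
    ∑ s ∈ Finset.range (k + 2), ∑ r : Fin (k + 1) → Bool × Bool,
      coef r • (revAlt k (wordD k s (ext r)) - revAlt k (wordE k s (ext r))) =
    (2 * (k + 2) * (2 * k + 3) * (-1 : ℚ) ^ (k + 1)) •
      altWord fun p : Fin (k + 2) => window k p := by
  rw [isAlt_revAlt.sum_word_sub, base_flipFun_revAlt, sub_neg_eq_add, ← two_smul ℚ, base_revAlt,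
    ← Nat.cast_smul_eq_nsmul ℚ, smul_smul, smul_smul]
  congr 1
  push_cast
  ring

end Windows

section Ratios

theorem dets_snoc_comp_perm {N n : ℕ} (c : Fin n → Fin N) (π : Equiv.Perm (Fin n)) :
    ∃ u : ℤˣ, ∀ x, dets N (n + 1) (Fin.snoc (c ∘ π) x) =
      ((u : ℤ) : FF N (n + 1)) * dets N (n + 1) (Fin.snoc c x) := by
  let π' : Equiv.Perm (Fin (n + 1)) :=
    (finSuccEquivLast.trans (Equiv.optionCongr π)).trans finSuccEquivLast.symm
  refine ⟨Equiv.Perm.sign π', fun x => ?_⟩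
  rw [← dets_comp_perm]
  congr 1
  funext p
  refine Fin.lastCases ?_ (fun q => ?_) p <;> simp [π']

variable {k : ℕ}

/-- The ratio of the determinants on the columns `c, 2k + 2` and `c, 2k + 3`. -/
noncomputable def ratio (c : Fin (k + 1) → Fin (2 * k + 4)) : FF (2 * k + 4) (k + 2) :=
  dets _ _ (Fin.snoc c ⟨2 * k + 2, by omega⟩ : Fin (k + 2) → _) /
    dets _ _ (Fin.snoc c ⟨2 * k + 3, by omega⟩ : Fin (k + 2) → _)

theorem ratio_congr {c d : Fin (k + 1) → Fin (2 * k + 4)} (hc : Function.Injective c)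
    (hd : Function.Injective d) (h : Set.range c = Set.range d) : ratio d = ratio c := by
  obtain ⟨π, rfl⟩ := exists_perm_of_range_eq hc hd h
  obtain ⟨u, hu⟩ := dets_snoc_comp_perm c π
  have h0 : ((u : ℤ) : FF (2 * k + 4) (k + 2)) ≠ 0 := by
    rcases Int.units_eq_one_or u with rfl | rfl <;> simp
  rw [ratio, ratio, hu, hu, mul_div_mul_left _ _ h0]

theorem permAut_ratio {σ : Equiv.Perm (Fin (2 * k + 4))} (h2 : σ ⟨2 * k + 2, by omega⟩ =
    ⟨2 * k + 2, by omega⟩) (h3 : σ ⟨2 * k + 3, by omega⟩ = ⟨2 * k + 3, by omega⟩)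
    (c : Fin (k + 1) → Fin (2 * k + 4)) :
    permAut _ (k + 2) σ (ratio c) = ratio (σ ∘ c) := by
  rw [ratio, ratio, map_div₀, permAut_dets, permAut_dets, Fin.comp_snoc, Fin.comp_snoc, h2, h3]

/-- The `k + 1` consecutive labels starting at `i`. -/
def arc (k i : ℕ) (t : Fin (k + 1)) : Fin (2 * k + 4) := fin2m k (i + t)

theorem arc_val {i : ℕ} (hi : i ≤ k + 1) (t : Fin (k + 1)) : (arc k i t).val = i + t :=
  Nat.mod_eq_of_lt (by omega)

theorem arc_injective {i : ℕ} (hi : i ≤ k + 1) : Function.Injective (arc k i) := fun s t h => by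
  have := congrArg Fin.val h
  rw [arc_val hi, arc_val hi] at this
  omega

theorem range_arc {i : ℕ} (hi : i ≤ k + 1) :
    Set.range (arc k i) = {v | i ≤ v.val ∧ v.val < i + k + 1} := by
  ext v
  simp only [Set.mem_range, Set.mem_ofPred_eq, Fin.ext_iff, arc_val hi]
  refine ⟨?_, fun h => ⟨⟨v - i, by omega⟩, by simp; omega⟩⟩
  rintro ⟨t, ht⟩
  omega

theorem grho_succ (k i : ℕ) : grho k (i + 1) = ratio (arc k i) := by
  have h : ∀ x y, y = fin2m k x → (fun t : Fin (k + 2) =>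
      if t.val < k + 1 then fin2m k (i + 1 - 1 + t.val) else fin2m k x) =
      Fin.snoc (arc k i) y := fun x y hy => by
    funext t
    refine Fin.lastCases ?_ (fun q => ?_) t
    · simp [hy]
    · simp only [Fin.val_castSucc, if_pos q.isLt, Fin.snoc_castSucc, arc, Nat.add_sub_cancel]
  rw [grho, ratio, gdet, gdet, h _ ⟨2 * k + 2, by omega⟩
    (Fin.ext (Nat.mod_eq_of_lt (by omega)).symm), h _ ⟨2 * k + 3, by omega⟩
    (Fin.ext (Nat.mod_eq_of_lt (by omega)).symm)]

theorem permAut_grho {i : ℕ} (hi : i ≤ k + 1) {a b : Fin (2 * k + 4)} (ha : a.val < 2 * k + 2)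
    (hb : b.val < 2 * k + 2)
    (h : (i ≤ a.val ∧ a.val < i + k + 1) ↔ (i ≤ b.val ∧ b.val < i + k + 1)) :
    permAut _ (k + 2) (Equiv.swap a b) (grho k (i + 1)) = grho k (i + 1) := by
  rw [grho_succ, permAut_ratio]
  · refine ratio_congr (arc_injective hi) ((Equiv.injective _).comp (arc_injective hi)) ?_
    rw [Set.range_comp, range_arc hi, Equiv.image_eq_preimage_symm, Equiv.symm_swap]
    ext v
    rw [Set.mem_preimage]
    rcases eq_or_ne v a with rfl | hva
    · rw [Equiv.swap_apply_left]
      exact h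
    rcases eq_or_ne v b with rfl | hvb
    · rw [Equiv.swap_apply_right]
      exact h.symm
    · rw [Equiv.swap_apply_of_ne_of_ne hva hvb]
  · exact Equiv.swap_apply_of_ne_of_ne (by simp [Fin.ext_iff]; omega)
      (by simp [Fin.ext_iff]; omega)
  · exact Equiv.swap_apply_of_ne_of_ne (by simp [Fin.ext_iff]; omega)
      (by simp [Fin.ext_iff]; omega)

/-- The `k` labels strictly between `i` and `i + k + 1`. -/
def midArc (k i : ℕ) (t : Fin k) : Fin (2 * k + 4) := fin2m k (i + 1 + t)

theorem midArc_val {i : ℕ} (hi : i ≤ k) (t : Fin k) : (midArc k i t).val = i + 1 + t :=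
  Nat.mod_eq_of_lt (by omega)

theorem mem_range_midArc {i : ℕ} (hi : i ≤ k) {v : Fin (2 * k + 4)} :
    v ∈ Set.range (midArc k i) ↔ i < v.val ∧ v.val < i + k + 1 := by
  simp only [Set.mem_range, Fin.ext_iff, midArc_val hi]
  refine ⟨?_, fun h => ⟨⟨v - i - 1, by omega⟩, by simp; omega⟩⟩
  rintro ⟨t, ht⟩
  omega

theorem midArc_injective {i : ℕ} (hi : i ≤ k) : Function.Injective (midArc k i) :=
  fun s t h => by
    have := congrArg Fin.val h
    rw [midArc_val hi, midArc_val hi] at this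
    omega

theorem cons_snoc_midArc_injective {i : ℕ} (hi : i ≤ k) {x y : Fin (2 * k + 4)}
    (hx : x.val ≤ i ∨ i + k + 1 ≤ x.val) (hy : y.val ≤ i ∨ i + k + 1 ≤ y.val) (hxy : x ≠ y) :
    Function.Injective (Fin.cons x (Fin.snoc (midArc k i) y : Fin (k + 1) → _) :
      Fin (k + 2) → _) := by
  rw [Fin.cons_injective_iff, Fin.snoc_injective_iff, Fin.range_snoc, Set.mem_insert_iff,
    mem_range_midArc hi, mem_range_midArc hi]
  exact ⟨by rintro (h | h); exacts [hxy h, by omega], midArc_injective hi, by omega⟩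

theorem wedge_ne_zero {i : ℕ} (hi : i ≤ k) {x y : Fin (2 * k + 4)}
    (hx : x.val ≤ i ∨ i + k + 1 ≤ x.val) (hy : y.val ≤ i ∨ i + k + 1 ≤ y.val) (hxy : x ≠ y) :
    wedge (midArc k i) x y ≠ 0 :=
  dets_ne_zero (cons_snoc_midArc_injective hi hx hy hxy)

theorem cls_wedge {i : ℕ} (hi : i ≤ k) {x y : Fin (2 * k + 4)}
    (hx : x.val ≤ i ∨ i + k + 1 ≤ x.val) (hy : y.val ≤ i ∨ i + k + 1 ≤ y.val) (hxy : x ≠ y)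
    {A : Set (Fin (2 * k + 4))}
    (hA : ∀ v, v ∈ A ↔ v = x ∨ v = y ∨ (i < v.val ∧ v.val < i + k + 1)) :
    cls (wedge (midArc k i) x y) = clsSet (k + 2) A := by
  refine cls_dets (cons_snoc_midArc_injective hi hx hy hxy) ?_
  ext v
  rw [hA, Fin.range_cons, Fin.range_snoc, Set.mem_insert_iff, Set.mem_insert_iff,
    mem_range_midArc hi]

theorem grho_eq_div {i : ℕ} (hi : i ≤ k + 1) {j : ℕ} (hj : j ≤ k) {x : Fin (2 * k + 4)}
    (h : (x.val = j ∧ i = j) ∨ (x.val = j + k + 1 ∧ i = j + 1)) :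
    grho k (i + 1) = wedge (midArc k j) x ⟨2 * k + 2, by omega⟩ /
      wedge (midArc k j) x ⟨2 * k + 3, by omega⟩ := by
  rw [grho_succ, wedge, wedge, Fin.cons_snoc_eq_snoc_cons, Fin.cons_snoc_eq_snoc_cons]
  refine ratio_congr (c := Fin.cons x (midArc k j)) ?_ (arc_injective hi) ?_
  · rw [Fin.cons_injective_iff, mem_range_midArc hj]
    exact ⟨by omega, midArc_injective hj⟩
  · ext v
    rw [range_arc hi, Fin.range_cons, Set.mem_insert_iff, mem_range_midArc hj, Fin.ext_iff,
      Set.mem_ofPred_eq]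
    omega

theorem grho_ne_zero {i : ℕ} (hi : i ≤ k + 1) : grho k (i + 1) ≠ 0 := by
  have h : ∀ x : Fin (2 * k + 4), 2 * k + 2 ≤ x.val →
      Function.Injective (Fin.snoc (arc k i) x : Fin (k + 2) → _) := fun x hx => by
    rw [Fin.snoc_injective_iff, range_arc hi, Set.mem_ofPred_eq]
    exact ⟨arc_injective hi, by omega⟩
  rw [grho_succ, ratio]
  exact div_ne_zero (dets_ne_zero (h _ le_rfl)) (dets_ne_zero (h _ (by simp)))

theorem cls_grho {i : ℕ} (hi : i ≤ k + 1) :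
    cls (grho k (i + 1)) = clsSet (k + 2) (letD k i) - clsSet (k + 2) (letE k i) := by
  have h : ∀ x : Fin (2 * k + 4), 2 * k + 2 ≤ x.val →
      Function.Injective (Fin.snoc (arc k i) x : Fin (k + 2) → _) := fun x hx => by
    rw [Fin.snoc_injective_iff, range_arc hi, Set.mem_ofPred_eq]
    exact ⟨arc_injective hi, by omega⟩
  rw [grho_succ, ratio, cls_div (dets_ne_zero (h _ le_rfl)) (dets_ne_zero (h _ (by simp)))]
  congr 1
  · refine cls_dets (h _ le_rfl) ?_
    ext v
    rw [Fin.range_snoc, range_arc hi, Set.mem_insert_iff, letD, Set.mem_ofPred_eq,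
      Set.mem_ofPred_eq, Fin.ext_iff]
    tauto
  · refine cls_dets (h _ (by simp)) ?_
    ext v
    rw [Fin.range_snoc, range_arc hi, Set.mem_insert_iff, letE, Set.mem_ofPred_eq,
      Set.mem_ofPred_eq, Fin.ext_iff]
    tauto

theorem grho_succ_sub {i : ℕ} (hi : i ≤ k) :
    grho k (i + 1 + 1) - grho k (i + 1) ≠ 0 ∧ cls (grho k (i + 1 + 1) - grho k (i + 1)) =
      clsSet (k + 2) (letL k i (true, true)) + clsSet (k + 2) (letL k i (false, false)) -
        clsSet (k + 2) (letE k (i + 1)) - clsSet (k + 2) (letE k i) := by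
  set u : Fin (2 * k + 4) := ⟨i, by omega⟩ with hu
  set v : Fin (2 * k + 4) := ⟨i + k + 1, by omega⟩ with hv
  set α : Fin (2 * k + 4) := ⟨2 * k + 2, by omega⟩ with hα
  set β : Fin (2 * k + 4) := ⟨2 * k + 3, by omega⟩ with hβ
  set w := wedge (midArc k i) with hw
  have huv : v ≠ u := by simp [hu, hv]; omega
  have hαβ : α ≠ β := by simp [hα, hβ]
  have hvβ : v ≠ β := by simp [hv, hβ]; omega
  have huβ : u ≠ β := by simp [hu, hβ]; omega
  have hu' : u.val ≤ i ∨ i + k + 1 ≤ u.val := Or.inl le_rfl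
  have hv' : v.val ≤ i ∨ i + k + 1 ≤ v.val := Or.inr le_rfl
  have hα' : α.val ≤ i ∨ i + k + 1 ≤ α.val := Or.inr (by simp [hα]; omega)
  have hβ' : β.val ≤ i ∨ i + k + 1 ≤ β.val := Or.inr (by simp [hβ]; omega)
  have h1 : w v u ≠ 0 := wedge_ne_zero hi hv' hu' huv
  have h2 : w α β ≠ 0 := wedge_ne_zero hi hα' hβ' hαβ
  have h3 : w v β ≠ 0 := wedge_ne_zero hi hv' hβ' hvβ
  have h4 : w u β ≠ 0 := wedge_ne_zero hi hu' hβ' huβ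
  have h : grho k (i + 1 + 1) - grho k (i + 1) = w v u * w α β / (w v β * w u β) := by
    rw [grho_eq_div (by omega) hi (x := v) (Or.inr ⟨rfl, rfl⟩),
      grho_eq_div (by omega) hi (x := u) (Or.inl ⟨rfl, rfl⟩), div_sub_div _ _ h3 h4]
    congr 1
    rw [sub_eq_iff_eq_add', wedge_pluecker]
    ring
  rw [h]
  refine ⟨div_ne_zero (mul_ne_zero h1 h2) (mul_ne_zero h3 h4), ?_⟩
  rw [cls_div (mul_ne_zero h1 h2) (mul_ne_zero h3 h4), cls_mul h1 h2, cls_mul h3 h4,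
    cls_wedge hi hv' hu' huv (A := letL k i (true, true)),
    cls_wedge hi hα' hβ' hαβ (A := letL k i (false, false)),
    cls_wedge hi hv' hβ' hvβ (A := letE k (i + 1)), cls_wedge hi hu' hβ' huβ (A := letE k i),
    sub_add_eq_sub_sub]
  all_goals
    intro x
    simp only [letL, letE, Set.mem_ofPred_eq, Fin.ext_iff, hu, hv, hα, hβ]
    grind

theorem tCoef_zero_zero_grho {i : ℕ} (hi : i ≤ k + 1) : tCoef 0 0 (grho k (i + 1)) =
    clsSet (k + 2) (letD k i) - clsSet (k + 2) (letE k i) := by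
  rw [tCoef, if_pos rfl, if_neg (grho_ne_zero hi).symm, sub_zero, cls_grho hi]

theorem tCoef_zero_grho {i : ℕ} (hi : i ≤ k) : tCoef 0 (grho k (i + 1)) (grho k (i + 1 + 1)) =
    ∑ e : Bool × Bool, (sg e.1 * sg e.2) • clsSet (k + 2) (letL k i e) := by
  obtain ⟨h0, h⟩ := grho_succ_sub hi
  have h1 := grho_ne_zero (k := k) (i := i) (by omega)
  have hD : letD k i = letL k i (true, false) := by
    ext v
    simp only [letL, letD, Set.mem_ofPred_eq]
    grind
  have hE : letE k (i + 1) = letL k i (false, true) := by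
    ext v
    simp only [letL, letE, Set.mem_ofPred_eq]
    grind
  rw [tCoef, if_neg h1.symm, if_neg (sub_ne_zero.mp h0).symm, zero_sub, cls_div h0
    (neg_ne_zero.mpr h1), cls_neg, h, cls_grho (by omega), hD, hE]
  simp only [Fintype.sum_prod_type, Fintype.sum_bool, sg]
  simp
  abel

theorem tCoef_grho {i : ℕ} (hi : i < k) :
    tCoef (grho k (i + 1)) (grho k (i + 1 + 1)) (grho k (i + 1 + 1 + 1)) =
      (clsSet (k + 2) (letL k (i + 1) (false, false)) - clsSet (k + 2) (letE k (i + 1 + 1)) -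
        clsSet (k + 2) (letL k i (true, true)) + clsSet (k + 2) (letE k i)) +
      (clsSet (k + 2) (letL k (i + 1) (true, true)) -
        clsSet (k + 2) (letL k i (false, false))) := by
  obtain ⟨h0, h⟩ := grho_succ_sub hi.le
  obtain ⟨h0', h'⟩ := grho_succ_sub (k := k) (i := i + 1) (by omega)
  rw [tCoef, if_neg (sub_ne_zero.mp h0).symm, if_neg (sub_ne_zero.mp h0').symm,
    ← neg_sub (grho k (i + 1 + 1)) (grho k (i + 1)), cls_div h0' (neg_ne_zero.mpr h0), cls_neg,
    h, h']
  abel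

end Ratios

section Reduction

variable {F : Type} [Field F] {V : Type*} [AddCommGroup V] [Module ℚ V]

/-- The functional `Φ` changes sign under `α j` and `β j` for `s ≤ j < k`. -/
def AntiFrom (k : ℕ) (α β : ℕ → F ≃+* F) (s : ℕ) {n : ℕ} (Φ : TP F n →ₗ[ℚ] V) : Prop :=
  ∀ j, s ≤ j → j < k → (∀ X, Φ (tpMap (α j) X) = -Φ X) ∧ ∀ X, Φ (tpMap (β j) X) = -Φ X

/-- The automorphisms `α j`, `β j` fix every `r i` with `i ≠ j + 1`, and the symbol factor at
`r (j + 1)` is a sum of an `α j`-invariant and a `β j`-invariant term. -/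
structure SplitSeq (k : ℕ) (r : ℕ → F) (α β : ℕ → F ≃+* F) : Prop where
  fix_left : ∀ j < k, ∀ i ≤ k + 1, i ≠ j + 1 → α j (r i) = r i
  fix_right : ∀ j < k, ∀ i ≤ k + 1, i ≠ j + 1 → β j (r i) = r i
  split : ∀ j < k, ∃ u u', tCoef (r j) (r (j + 1)) (r (j + 2)) = u + u' ∧
    vmap (α j) u = u ∧ vmap (β j) u' = u'

theorem eq_zero_of_eq_neg_self {x : V} (h : x = -x) : x = 0 := by
  have h2 : (2 : ℚ) • x = 0 := by
    rw [two_smul]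
    nth_rewrite 1 [h]
    exact neg_add_cancel x
  exact (smul_eq_zero.mp h2).resolve_left two_ne_zero

theorem SIaux_congr {n : ℕ} {a b : F} {as as' : List F} (h : as = as') (h1 : as.length = n)
    (h2 : as'.length = n) : SIaux n a as b h1 = SIaux n a as' b h2 := by
  subst h
  rfl

theorem snoc_SIaux_congr {n : ℕ} {a b : F} {as as' : List F} {t t' : VF F} (h1 : as.length = n)
    (h2 : as'.length = n) (h : as = as') (ht : t = t') :
    snoc (SIaux n a as b h1) t = snoc (SIaux n a as' b h2) t' := by
  rw [ht, SIaux_congr h h1 h2]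

theorem tpMap_SIaux_of_fixed {φ : F ≃+* F} {n : ℕ} {as : List F} {b : F} (h : as.length = n)
    (has : ∀ x ∈ as, φ x = x) (hb : φ b = b) :
    tpMap φ (SIaux n 0 as b h) = SIaux n 0 as b h := by
  have hm : as.map φ = as := by
    conv_rhs => rw [← List.map_id as]
    exact List.map_congr_left has
  rw [tpMap_SIaux φ n 0 as b h (by rw [hm, h])]
  simp only [map_zero, hb]
  exact SIaux_congr hm _ _

variable {k : ℕ} {r : ℕ → F} {α β : ℕ → F ≃+* F}

theorem SplitSeq.apply_snoc_eq_zero (hr : SplitSeq k r α β) {s n : ℕ}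
    {Φ : TP F (n + 1) →ₗ[ℚ] V} (hΦ : AntiFrom k α β s Φ) {j : ℕ} (hs : s ≤ j) (hj : j < k)
    {as : List F} (h : as.length = n) (has : ∀ x ∈ as, x = 0 ∨ ∃ i ≤ k + 1, i ≠ j + 1 ∧ x = r i) :
    Φ (snoc (SIaux n 0 as (r (k + 1)) h) (tCoef (r j) (r (j + 1)) (r (j + 2)))) = 0 := by
  obtain ⟨u, u', hu, h1, h2⟩ := hr.split j hj
  have hα : tpMap (α j) (SIaux n 0 as (r (k + 1)) h) = SIaux n 0 as (r (k + 1)) h := by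
    refine tpMap_SIaux_of_fixed h (fun x hx => ?_) (hr.fix_left j hj _ le_rfl (by omega))
    obtain rfl | ⟨i, hi, hij, rfl⟩ := has x hx
    · exact map_zero _
    · exact hr.fix_left j hj i hi hij
  have hβ : tpMap (β j) (SIaux n 0 as (r (k + 1)) h) = SIaux n 0 as (r (k + 1)) h := by
    refine tpMap_SIaux_of_fixed h (fun x hx => ?_) (hr.fix_right j hj _ le_rfl (by omega))
    obtain rfl | ⟨i, hi, hij, rfl⟩ := has x hx
    · exact map_zero _
    · exact hr.fix_right j hj i hi hij
  have e1 := (hΦ j hs hj).1 (snoc (SIaux n 0 as (r (k + 1)) h) u)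
  have e2 := (hΦ j hs hj).2 (snoc (SIaux n 0 as (r (k + 1)) h) u')
  rw [tpMap_snoc, hα, h1] at e1
  rw [tpMap_snoc, hβ, h2] at e2
  rw [hu, map_add, map_add, eq_zero_of_eq_neg_self e1, eq_zero_of_eq_neg_self e2, add_zero]

theorem AntiFrom.comp_snoc {s t n : ℕ} {Φ : TP F (n + 1) →ₗ[ℚ] V}
    (hΦ : AntiFrom k α β s Φ) (hst : s ≤ t) {v : VF F}
    (hv : ∀ j, t ≤ j → j < k → vmap (α j) v = v ∧ vmap (β j) v = v) :
    AntiFrom k α β t (Φ ∘ₗ snoc.flip v) := by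
  intro j htj hj
  obtain ⟨h1, h2⟩ := hv j htj hj
  refine ⟨fun X => ?_, fun X => ?_⟩
  · have := (hΦ j (hst.trans htj) hj).1 (snoc X v)
    rwa [tpMap_snoc, h1] at this
  · have := (hΦ j (hst.trans htj) hj).2 (snoc X v)
    rwa [tpMap_snoc, h2] at this

theorem getD_map_range' {s l i : ℕ} (h : i < l) :
    ((List.range' s l).map r).getD i 0 = r (s + i) := by
  simp [List.getD, h]

theorem getD_map_range'_append {s l i : ℕ} (h : i ≤ l) :
    ((List.range' s l).map r ++ [r (s + l)]).getD i 0 = r (s + i) := by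
  have : (List.range' s l).map r ++ [r (s + l)] = (List.range' s (l + 1)).map r := by
    simp [List.range'_concat]
  rw [this, getD_map_range' (by omega)]

theorem mem_eraseIdx_map_range' {F : Type*} {r : ℕ → F} {s l i : ℕ} {x : F}
    (hx : x ∈ ((List.range' s l).map r).eraseIdx i) : ∃ j < l, j ≠ i ∧ x = r (s + j) := by
  rw [List.mem_eraseIdx_iff_getElem] at hx
  obtain ⟨j, hj, hji, rfl⟩ := hx
  refine ⟨j, by simpa using hj, hji, by simp⟩

theorem SplitSeq.fix_tCoef_zero (hr : SplitSeq k r α β) {s : ℕ} (hs : s ≤ k) {j : ℕ}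
    (hsj : s + 1 ≤ j) (hj : j < k) :
    vmap (α j) (tCoef 0 (r s) (r (s + 1))) = tCoef 0 (r s) (r (s + 1)) ∧
      vmap (β j) (tCoef 0 (r s) (r (s + 1))) = tCoef 0 (r s) (r (s + 1)) := by
  rw [vmap_tCoef, vmap_tCoef, hr.fix_left j hj s (by omega) (by omega),
    hr.fix_left j hj (s + 1) (by omega) (by omega), hr.fix_right j hj s (by omega) (by omega),
    hr.fix_right j hj (s + 1) (by omega) (by omega), map_zero, map_zero]
  exact ⟨rfl, rfl⟩

theorem SplitSeq.fix_tCoef_zero_zero (hr : SplitSeq k r α β) {s : ℕ} (hs : s ≤ k + 1) {j : ℕ}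
    (hsj : s ≤ j) (hj : j < k) :
    vmap (α j) (tCoef 0 0 (r s)) = tCoef 0 0 (r s) ∧
      vmap (β j) (tCoef 0 0 (r s)) = tCoef 0 0 (r s) := by
  rw [vmap_tCoef, vmap_tCoef, hr.fix_left j hj s (by omega) (by omega),
    hr.fix_right j hj s (by omega) (by omega), map_zero, map_zero]
  exact ⟨rfl, rfl⟩

theorem SplitSeq.apply_SIaux (hr : SplitSeq k r α β) : ∀ (l s : ℕ) (Φ : TP F l →ₗ[ℚ] V)
    (h : ((List.range' s l).map r).length = l), s + l = k + 1 → AntiFrom k α β s Φ →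
    Φ (SIaux l 0 ((List.range' s l).map r) (r (k + 1)) h) =
      Φ (tprod ℚ fun p => tCoef 0 (r (s + l - 1 - p)) (r (s + l - 1 - p + 1)))
  | 0, s, Φ, h, _, _ => by
    rw [SIaux]
    congr 2
    exact Subsingleton.elim _ _
  | l + 1, s, Φ, h, hk, hΦ => by
    rw [SIaux, map_sum, Fin.sum_univ_succ, Finset.sum_eq_zero, add_zero]
    · have hl : ((List.range' (s + 1) l).map r).length = l := by simp
      have ih := hr.apply_SIaux l (s + 1) (Φ ∘ₗ snoc.flip (tCoef 0 (r s) (r (s + 1)))) hl (by omega)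
        (hΦ.comp_snoc (by omega) fun j hj hjk => hr.fix_tCoef_zero (by omega) hj hjk)
      simp only [LinearMap.comp_apply, LinearMap.flip_apply, snoc_tprod] at ih
      refine (congrArg Φ (snoc_SIaux_congr _ hl ?_ ?_)).trans
        (ih.trans (congrArg _ (congrArg _ ?_)))
      · simp [List.range'_succ]
      · rw [← hk, Fin.val_zero, getD_map_range' (by omega), getD_map_range'_append (by omega),
          List.getD_cons_zero, add_zero, zero_add]
      funext p
      refine Fin.lastCases ?_ (fun q => ?_) p
      · simp
      · have : s + 1 + l - 1 - q.val = s + (l + 1) - 1 - q.val := by omega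
        simp only [Fin.snoc_castSucc, Fin.val_castSucc, this]
    · intro i _
      have hi := i.isLt
      refine (congrArg Φ (snoc_SIaux_congr _
        (as' := ((List.range' s (l + 1)).map r).eraseIdx (i + 1))
        (by simp [List.length_eraseIdx]) rfl ?_)).trans
        (hr.apply_snoc_eq_zero hΦ (j := s + i) (by omega) (by omega) _ fun x hx => Or.inr ?_)
      · rw [← hk, Fin.val_succ, getD_map_range' (by omega), getD_map_range'_append (by omega),
          List.getD_cons_succ, getD_map_range' (by omega)]
        rfl
      · obtain ⟨j, hj, hji, rfl⟩ := mem_eraseIdx_map_range' hx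
        exact ⟨s + j, by omega, by omega, rfl⟩

theorem SplitSeq.apply_SIaux_zero (hr : SplitSeq k r α β) : ∀ (l s : ℕ) (Φ : TP F (l + 1) →ₗ[ℚ] V)
    (h : (0 :: (List.range' s l).map r).length = l + 1), s + l = k + 1 → AntiFrom k α β s Φ →
    Φ (SIaux (l + 1) 0 (0 :: (List.range' s l).map r) (r (k + 1)) h) =
      ∑ q ∈ Finset.range (l + 1), Φ (tprod ℚ fun p : Fin (l + 1) =>
        insWord (s + q) (fun i => tCoef 0 (r i) (r (i + 1))) (tCoef 0 0 (r (s + q)))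
          (s + l - p)) := by
  intro l
  induction l with
  | zero =>
    intro s Φ h hk hΦ
    rw [SIaux, map_sum, Fin.sum_univ_succ, Finset.sum_range_one, Fin.sum_univ_zero, add_zero, SIaux,
      snoc_tprod]
    refine congrArg _ (congrArg _ ?_)
    funext p
    refine Fin.lastCases ?_ (fun q => q.elim0) p
    simp [insWord_self, ← hk]
    rfl
  | succ l ih =>
    intro s Φ h hk hΦ
    rw [SIaux, map_sum, Fin.sum_univ_succ, Fin.sum_univ_succ, Finset.sum_eq_zero, add_zero,
      Finset.sum_range_succ', add_comm]
    · congr 1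
      · have hl : (0 :: (List.range' (s + 1) l).map r).length = l + 1 := by simp
        have ih' := ih (s + 1) (Φ ∘ₗ snoc.flip (tCoef 0 (r s) (r (s + 1)))) hl
          (by omega) (hΦ.comp_snoc (by omega) fun j hj hjk => hr.fix_tCoef_zero (by omega) hj hjk)
        simp only [LinearMap.comp_apply, LinearMap.flip_apply, snoc_tprod] at ih'
        refine (congrArg Φ (snoc_SIaux_congr _ hl ?_ ?_)).trans
          (ih'.trans (Finset.sum_congr rfl fun q _ => congrArg _ (congrArg _ ?_)))
        · simp [List.range'_succ]
        · rw [← hk, Fin.val_succ, Fin.val_zero, List.getD_cons_succ, List.getD_cons_succ,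
            List.getD_cons_zero, List.cons_append, List.getD_cons_succ,
            getD_map_range' (by omega), getD_map_range'_append (by omega), add_zero]
        funext p
        have hq : s + 1 + q = s + (q + 1) := by omega
        rw [hq]
        refine Fin.lastCases ?_ (fun p' => ?_) p
        · rw [Fin.snoc_last, Fin.val_last, insWord_of_lt (by omega), Nat.add_sub_cancel]
        · have : s + 1 + l - p'.val = s + (l + 1) - p'.val := by omega
          simp only [Fin.snoc_castSucc, Fin.val_castSucc, this]
      · have hl : ((List.range' s (l + 1)).map r).length = l + 1 := by simp
        have h0 := hr.apply_SIaux (l + 1) s (Φ ∘ₗ snoc.flip (tCoef 0 0 (r s))) hl hk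
          (hΦ.comp_snoc le_rfl fun j hj hjk => hr.fix_tCoef_zero_zero (by omega) hj hjk)
        simp only [LinearMap.comp_apply, LinearMap.flip_apply, snoc_tprod] at h0
        refine (congrArg Φ (snoc_SIaux_congr _ hl rfl ?_)).trans
          (h0.trans (congrArg _ (congrArg _ ?_)))
        · rw [← hk, Fin.val_zero, List.getD_cons_zero, List.getD_cons_zero, List.cons_append,
            List.getD_cons_succ, getD_map_range'_append (by omega), add_zero]
        funext p
        refine Fin.lastCases ?_ (fun q => ?_) p
        · simp [insWord_self]
        · have : s + (l + 1) - q.val = s + (l + 1) - 1 - q.val + 1 := by omega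
          simp only [Fin.snoc_castSucc, Fin.val_castSucc]
          rw [this, insWord_of_gt (by omega)]
    · intro i _
      have hi := i.isLt
      refine (congrArg Φ (snoc_SIaux_congr _
        (as' := 0 :: ((List.range' s (l + 1)).map r).eraseIdx (i + 1))
        (by simp [List.length_eraseIdx]) (by simp) ?_)).trans
        (hr.apply_snoc_eq_zero hΦ (j := s + i) (by omega) (by omega) _ fun x hx => ?_)
      · simp only [Fin.val_succ, List.cons_append, List.getD_cons_succ]
        rw [← hk, getD_map_range' (by omega), getD_map_range'_append (by omega),
          getD_map_range' (by omega)]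
        rfl
      · obtain rfl | hx := List.mem_cons.mp hx
        · exact Or.inl rfl
        · obtain ⟨j, hj, hji, rfl⟩ := mem_eraseIdx_map_range' hx
          exact Or.inr ⟨s + j, by omega, by omega, rfl⟩

end Reduction

section Expansion

theorem apply_insWord {α γ : Type*} (f : α → γ) (q : ℕ) (L : ℕ → α) (z : α) (p : ℕ) :
    f (insWord q L z p) = insWord q (fun i => f (L i)) (f z) p := by
  rcases lt_trichotomy p q with h | rfl | h
  · rw [insWord_of_lt h, insWord_of_lt h]
  · rw [insWord_self, insWord_self]
  · obtain ⟨p, rfl⟩ := Nat.exists_eq_add_of_lt (Nat.zero_lt_of_lt h)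
    rw [insWord_of_gt (by omega), insWord_of_gt (by omega)]

theorem insertNth_eq_insWord {α : Type*} {n : ℕ} (q : Fin (n + 1)) (L : ℕ → α) (z : α) :
    (q.insertNth z fun i : Fin n => L i : Fin (n + 1) → α) =
      fun p : Fin (n + 1) => insWord q L z p := by
  funext p
  refine Fin.succAboveCases q ?_ (fun i => ?_) p
  · rw [Fin.insertNth_apply_same, insWord_self]
  · rw [Fin.insertNth_apply_succAbove]
    rcases lt_or_ge i.val q.val with h | h
    · rw [Fin.succAbove_of_castSucc_lt _ _ h, Fin.val_castSucc, insWord_of_lt h]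
    · rw [Fin.succAbove_of_le_castSucc _ _ h, Fin.val_succ, insWord_of_gt h]

theorem map_sum_smul {ι V W : Type*} [AddCommGroup V] [Module ℚ V] [AddCommGroup W] [Module ℚ W]
    [Fintype ι] {n : ℕ} (f : MultilinearMap ℚ (fun _ : Fin n => V) W) (c : ι → ℚ)
    (x : Fin n → ι → V) :
    f (fun i => ∑ e, c e • x i e) =
      ∑ r : Fin n → ι, (∏ i, c (r i)) • f fun i => x i (r i) := by
  rw [MultilinearMap.map_sum]
  exact Finset.sum_congr rfl fun r _ => MultilinearMap.map_smul_univ _ _ _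

variable {k : ℕ}

theorem altHom_insWord {q : ℕ} (hq : q ≤ k + 1) {L : ℕ → VF (FF (2 * k + 4) (k + 2))}
    (hL : ∀ i ≤ k, L i = ∑ e : Bool × Bool, (sg e.1 * sg e.2) • clsSet (k + 2) (letL k i e)) :
    altHom _ _ _ (tprod ℚ fun p : Fin (k + 2) =>
        insWord q L (clsSet (k + 2) (letD k q) - clsSet (k + 2) (letE k q)) (k + 1 - p)) =
      ∑ r : Fin (k + 1) → Bool × Bool,
        coef r • (revAlt k (wordD k q (ext r)) - revAlt k (wordE k q (ext r))) := by
  let g : MultilinearMap ℚ (fun _ : Fin (k + 2) => VF (FF (2 * k + 4) (k + 2))) _ :=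
    ((altHom (2 * k + 4) (k + 2) (k + 2)).compMultilinearMap (tprod ℚ)).domDomCongr Fin.revPerm
  have hg : ∀ f : ℕ → VF (FF (2 * k + 4) (k + 2)), g (fun p => f p) =
      altHom _ _ _ (tprod ℚ fun p : Fin (k + 2) => f (k + 1 - p)) := fun f => by
    simp only [g, MultilinearMap.domDomCongr_apply, LinearMap.compMultilinearMap_apply,
      Fin.revPerm_apply, Fin.val_rev]
    refine congrArg _ (congrArg _ (funext fun p => congrArg f ?_))
    omega
  let Q : Fin (k + 2) := ⟨q, by omega⟩
  have hw : ∀ (r : Fin (k + 1) → Bool × Bool) (A : Set (Fin (2 * k + 4))),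
      g.curryMid Q (clsSet (k + 2) A) (fun i => clsSet (k + 2) (letL k i (r i))) =
        revAlt k fun p => insWord q (fun i => letL k i (ext r i)) A p := fun r A => by
    have := insertNth_eq_insWord Q (fun i => clsSet (k + 2) (letL k i (ext r i)))
      (clsSet (k + 2) A)
    simp only [ext_coe] at this
    rw [MultilinearMap.curryMid_apply_apply, this, hg fun p => insWord q _ _ p,
      altHom_apply, revAlt, altWord]
    simp only [apply_insWord (clsSet (k + 2)), Fin.val_rev]
    refine congrArg _ (congrArg _ (funext fun p => congrArg _ ?_))
    omega
  have h0 : (fun i : Fin (k + 1) => L i) = fun i : Fin (k + 1) =>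
      ∑ e : Bool × Bool, (sg e.1 * sg e.2) • clsSet (k + 2) (letL k i e) :=
    funext fun i => hL i (by omega)
  rw [← hg fun p => insWord q L _ p, ← insertNth_eq_insWord Q,
    ← MultilinearMap.curryMid_apply_apply, h0, map_sum_smul]
  refine Finset.sum_congr rfl fun r _ => congrArg _ ?_
  rw [map_sub, sub_apply, hw, hw]
  rfl

end Expansion

section Assembly

theorem image_swap_eq_self {α : Type*} [DecidableEq α] {a b : α} {A : Set α}
    (h : a ∈ A ↔ b ∈ A) : Equiv.swap a b '' A = A := by
  ext v
  rw [Equiv.image_eq_preimage_symm, Equiv.symm_swap, Set.mem_preimage]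
  rcases eq_or_ne v a with rfl | hva
  · rw [Equiv.swap_apply_left, h]
  rcases eq_or_ne v b with rfl | hvb
  · rw [Equiv.swap_apply_right, h]
  · rw [Equiv.swap_apply_of_ne_of_ne hva hvb]

theorem vmap_swap_clsSet {N m : ℕ} {a b : Fin N} {A : Set (Fin N)} (h : a ∈ A ↔ b ∈ A) :
    vmap (permAut N m (Equiv.swap a b)) (clsSet m A) = clsSet m A := by
  rw [vmap_clsSet, image_swap_eq_self h]

variable {k : ℕ}

theorem fin2m_val {x : ℕ} (hx : x < 2 * k + 4) : (fin2m k x).val = x := Nat.mod_eq_of_lt hx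

theorem altHom_swap {N m n : ℕ} {a b : Fin N} (hab : a ≠ b) (X : TP (FF N m) n) :
    altHom N m n (tpMap (permAut N m (Equiv.swap a b)) X) = -altHom N m n X := by
  rw [altHom_apply, altHom_apply, Alt_tpMap, Equiv.Perm.sign_swap hab]
  simp

theorem splitSeq_grho : SplitSeq k (fun i => grho k (i + 1))
    (fun j => permAut _ _ (Equiv.swap (fin2m k j) (fin2m k (j + 1))))
    (fun j => permAut _ _ (Equiv.swap (fin2m k (j + k + 1)) (fin2m k (j + k + 2)))) where
  fix_left j hj i hi hij := by
    apply permAut_grho hi <;> rw [fin2m_val (by omega)] <;> try rw [fin2m_val (by omega)]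
    all_goals omega
  fix_right j hj i hi hij := by
    apply permAut_grho hi <;> rw [fin2m_val (by omega)] <;> try rw [fin2m_val (by omega)]
    all_goals omega
  split j hj := by
    refine ⟨_, _, tCoef_grho hj, ?_, ?_⟩
    · have h0 := fin2m_val (k := k) (x := j) (by omega)
      have h1 := fin2m_val (k := k) (x := j + 1) (by omega)
      rw [map_add, map_sub, map_sub, vmap_swap_clsSet, vmap_swap_clsSet, vmap_swap_clsSet,
        vmap_swap_clsSet]
      all_goals simp only [letL, letE, Set.mem_ofPred_eq, h0, h1]
      all_goals grind
    · have h0 := fin2m_val (k := k) (x := j + k + 1) (by omega)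
      have h1 := fin2m_val (k := k) (x := j + k + 2) (by omega)
      rw [map_sub, vmap_swap_clsSet, vmap_swap_clsSet]
      all_goals simp only [letL, Set.mem_ofPred_eq, h0, h1]
      all_goals grind

theorem cls_gdet_window (j : Fin (k + 2)) :
    cls (gdet k fun c => fin2m k (j + c)) = clsSet (k + 2) (window k j) := by
  have hv : ∀ c : Fin (k + 2), (fin2m k (j + c)).val = j + c := fun c => fin2m_val (by omega)
  refine cls_dets (fun c d h => ?_) ?_
  · have := congrArg Fin.val h
    rw [hv, hv] at this
    omega
  · ext v
    simp only [Set.mem_range, window, Set.mem_ofPred_eq, Fin.ext_iff, hv]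
    refine ⟨?_, fun h => ⟨⟨v - j, by omega⟩, by simp; omega⟩⟩
    rintro ⟨t, ht⟩
    omega

theorem SGrm_eq_altWord : SGrm k = ((2 : ℚ) * (-1) ^ (k + 2) * (Nat.factorial (k + 2) : ℚ) ^ 2) •
    altWord fun p : Fin (k + 2) => window k p := by
  simp only [SGrm, altWord, cls_gdet_window]

theorem Alt_SIaux_grho (h : (0 :: (List.range' 0 (k + 1)).map
    fun i => grho k (i + 1)).length = k + 2) :
    Alt (SIaux (k + 2) 0 (0 :: (List.range' 0 (k + 1)).map fun i => grho k (i + 1))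
      (grho k (k + 2)) h) =
    (2 * (k + 2) * (2 * k + 3) * (-1 : ℚ) ^ (k + 1)) •
      altWord fun p : Fin (k + 2) => window k p := by
  have hne : ∀ x, x + 1 < 2 * k + 4 → fin2m k x ≠ fin2m k (x + 1) := fun x hx h => by
    have := congrArg Fin.val h
    rw [fin2m_val (by omega), fin2m_val hx] at this
    omega
  rw [← altHom_apply, ← sum_revAlt]
  refine (splitSeq_grho.apply_SIaux_zero (k + 1) 0 (altHom _ _ _) h (by omega) fun j _ hj =>
    ⟨altHom_swap (hne _ (by omega)), altHom_swap (hne _ (by omega))⟩).trans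
    (Finset.sum_congr rfl fun q hq => ?_)
  have hq' : q ≤ k + 1 := by
    have := Finset.mem_range.mp hq
    omega
  rw [← altHom_insWord hq' fun i hi => tCoef_zero_grho hi]
  simp only [zero_add, tCoef_zero_zero_grho hq']

end Assembly

end GrassPoly

/-- Theorem `i211`: for `m = k + 2 ≥ 2`,
`-((2m-1)/(m!·(m-1)!)) · S(Gr_m) = Alt_{2m} S I(0; 0, ρ₁, …, ρ_{m-1}; ρ_m)`. -/
theorem grassmannian_symbol_iterated_integral (k : ℕ) :
    (-((2 * (k : ℚ) + 3) / ((Nat.factorial (k + 2) : ℚ) * (Nat.factorial (k + 1) : ℚ)))) •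
        SGrm k =
      Alt (SIaux (k + 2) 0
        (0 :: List.ofFn (fun t : Fin (k + 1) => grho k (t.val + 1)))
        (grho k (k + 2))
        (by rw [List.length_cons, List.length_ofFn])) := by
  have hl : List.ofFn (fun t : Fin (k + 1) => grho k (t.val + 1)) =
      (List.range' 0 (k + 1)).map fun i => grho k (i + 1) := by
    refine List.ext_getElem (by simp) fun i h1 h2 => ?_
    rw [List.getElem_ofFn, List.getElem_map, List.getElem_range', zero_add, one_mul]
  have hm : (0 :: (List.range' 0 (k + 1)).map fun i => grho k (i + 1)).length = k + 2 := by simp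
  rw [SIaux_congr (congrArg (List.cons 0) hl) _ hm, Alt_SIaux_grho, SGrm_eq_altWord, smul_smul]
  congr 1
  have h1 : ((k + 1).factorial : ℚ) ≠ 0 := Nat.cast_ne_zero.mpr (Nat.factorial_ne_zero _)
  have h2 : (k : ℚ) + 2 ≠ 0 := by positivity
  rw [Nat.factorial_succ (k + 1)]
  push_cast
  field_simp
  ring
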